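/- arXiv:2111.05662 — 2 statements merged into one kernel-verified Lean document; each statement's English description precedes it below -/
import Mathlib

section
/- Fix integers M ≥ 2 and ℓ ≥ 1. For each positive integer q let S_q = {x_0 < x_1 < … < x_{T(q)−1}} ⊆ Z_q be a subset of size T(q) satisfying (log log log q / log log q)·q ≤ T(q) ≤ q, T(q) = o(q), and C(S_q, q, ℓM log log q) = o( T(q) / (log q)^{ℓM} ) as q → ∞, and let (s_n) be the M-ary sequence s_n ≡ x_{n+1} − x_n (mod M), n = 0,…,T(q)−2. Then for every pattern (a_0,…,a_{ℓ−1}) ∈ {1,…,M}^ℓ, the number of n ∈ {0,…,T(q)−ℓ−1} with s_{n+i} ≡ a_i (mod M) for all i = 0,…,ℓ−1 equals (M^{−ℓ} + o(1))·T(q) as q → ∞; that is, (s_n) has asymptotically uniform pattern distribution of length ℓ. -/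
open Finset Filter

/-- The function `f_R` from the paper: `1 - |R|/q` on `R`, `-|R|/q` off `R`. -/
noncomputable def fsub (q : ℕ) (R : Finset ℕ) (n : ℕ) : ℝ :=
  if n % q ∈ R then 1 - (R.card : ℝ) / q else -((R.card : ℝ) / q)

/-- The correlation measure `C_k(R,q)` of order `k` of a subset `R ⊆ Z_q`. -/
noncomputable def corrK (R : Finset ℕ) (q k : ℕ) : ℝ :=
  sSup {x : ℝ | ∃ (M : ℕ) (d : Fin k → ℕ), 1 ≤ M ∧ M ≤ q ∧ StrictMono d ∧
    (∀ i, d i ≤ q - 1) ∧ x = |∑ n ∈ Finset.range M, ∏ i, fsub q R (n + d i)|}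

/-- `C(R,q,s) = max_{1 ≤ k ≤ s} C_k(R,q)`. -/
noncomputable def corrMeasure (R : Finset ℕ) (q s : ℕ) : ℝ :=
  sSup {x : ℝ | ∃ k, 1 ≤ k ∧ k ≤ s ∧ x = corrK R q k}

theorem abs_fsub_le_one {q : ℕ} {R : Finset ℕ} (hR : R.card ≤ q) (n : ℕ) :
    |fsub q R n| ≤ 1 := by
  have h0 : 0 ≤ (R.card : ℝ) / q := by positivity
  have h1 : (R.card : ℝ) / q ≤ 1 := div_le_one_of_le₀ (by exact_mod_cast hR) (by positivity)
  unfold fsub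
  split_ifs <;> rw [abs_le] <;> constructor <;> linarith

theorem abs_sum_prod_fsub_le_corrMeasure {q s m : ℕ} {R A : Finset ℕ} (hR : R.card ≤ q)
    (hs : s ≤ q) (hA : A.Nonempty) (hAs : A ⊆ range s) (hm : 1 ≤ m) (hmq : m ≤ q) :
    |∑ n ∈ range m, ∏ t ∈ A, fsub q R (n + t)| ≤ corrMeasure R q s := by
  have hcard : A.card ≤ s := by simpa using card_le_card hAs
  have hle : |∑ n ∈ range m, ∏ t ∈ A, fsub q R (n + t)| ≤ corrK R q A.card := by
    refine le_csSup ⟨q, ?_⟩ ⟨m, A.orderEmbOfFin rfl, hm, hmq, (A.orderEmbOfFin rfl).strictMono,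
      fun i ↦ ?_, ?_⟩
    · rintro _ ⟨m, d, -, hmq, -, -, rfl⟩
      calc _ ≤ ∑ n ∈ range m, |∏ i, fsub q R (n + d i)| := abs_sum_le_sum_abs _ _
        _ ≤ ∑ n ∈ range m, (1 : ℝ) := sum_le_sum fun n _ ↦ by
          rw [abs_prod]
          exact prod_le_one (fun _ _ ↦ abs_nonneg _) fun _ _ ↦ abs_fsub_le_one hR _
        _ ≤ q := by simpa using hmq
    · have := mem_range.1 (hAs (A.orderEmbOfFin_mem rfl i))
      omega
    · congr 1
      refine sum_congr rfl fun n _ ↦ ?_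
      conv_lhs => rw [← A.map_orderEmbOfFin_univ rfl, prod_map]
      rfl
  refine hle.trans (le_csSup ?_ ⟨A.card, hA.card_pos, hcard, rfl⟩)
  refine (((Set.finite_Icc 1 s).image (corrK R q)).subset ?_).bddAbove
  rintro _ ⟨k, h1, h2, rfl⟩
  exact ⟨k, ⟨h1, h2⟩, rfl⟩

/-- Expanding indicator functions: the number of translates of a pattern `P ⊆ [0, L]` matched
exactly by `R` is at least its expected value minus a correlation error. -/
theorem le_card_filter_pattern {q L : ℕ} {R P : Finset ℕ} {C : ℝ} (hR : R.card ≤ q) (hL : L < q)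
    (hP : P ⊆ range (L + 1))
    (hC : ∀ A ⊆ range (L + 1), A.Nonempty →
      |∑ n ∈ range (q - L), ∏ t ∈ A, fsub q R (n + t)| ≤ C) :
    ((q : ℝ) - L) * (((R.card : ℝ) / q) ^ P.card * (1 - (R.card : ℝ) / q) ^ (L + 1 - P.card))
        - 2 ^ (L + 1) * C ≤
      ((range (q - L)).filter fun y ↦ ∀ t ∈ range (L + 1), (y + t ∈ R ↔ t ∈ P)).card := by
  set δ : ℝ := (R.card : ℝ) / q with hδ
  have h0 : 0 ≤ δ := by positivity
  have h1 : δ ≤ 1 := div_le_one_of_le₀ (by exact_mod_cast hR) (by positivity)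
  have hC0 : 0 ≤ C := (abs_nonneg _).trans (hC {0} (by simp) (by simp))
  let c : ℕ → ℝ := fun t ↦ if t ∈ P then δ else 1 - δ
  let e : ℕ → ℝ := fun t ↦ if t ∈ P then 1 else -1
  have hc0 : ∀ t, |c t| ≤ 1 := fun t ↦ by
    simp only [c]; split_ifs <;> rw [abs_le] <;> constructor <;> linarith
  have he : ∀ t, |e t| ≤ 1 := fun t ↦ by
    simp only [e]; split_ifs <;> simp
  have hcard : (((range (q - L)).filter
      fun y ↦ ∀ t ∈ range (L + 1), (y + t ∈ R ↔ t ∈ P)).card : ℝ) =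
      ∑ A ∈ (range (L + 1)).powerset, ((∏ t ∈ A, e t) * ∏ t ∈ range (L + 1) \ A, c t) *
        ∑ y ∈ range (q - L), ∏ t ∈ A, fsub q R (y + t) := by
    rw [card_filter]
    push_cast
    simp_rw [mul_sum]
    rw [sum_comm]
    refine sum_congr rfl fun y hy ↦ ?_
    have hy' : y < q - L := mem_range.1 hy
    rw [← Finset.prod_boole]
    calc _ = ∏ t ∈ range (L + 1), (e t * fsub q R (y + t) + c t) := by
          refine prod_congr rfl fun t ht ↦ ?_
          have ht' : t < L + 1 := mem_range.1 ht
          have hmod : (y + t) % q = y + t := Nat.mod_eq_of_lt (by omega)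
          simp only [e, c, fsub, hmod, ← hδ]
          by_cases hyR : y + t ∈ R <;> by_cases htP : t ∈ P <;> simp [hyR, htP]
      _ = _ := by
          rw [prod_add]
          refine sum_congr rfl fun A _ ↦ ?_
          rw [prod_mul_distrib]
          ring
  have hmain : ∏ t ∈ range (L + 1), c t = δ ^ P.card * (1 - δ) ^ (L + 1 - P.card) := by
    simp only [c]
    rw [prod_ite, prod_const, prod_const, filter_not, filter_mem_eq_inter,
      inter_eq_right.2 hP, card_sdiff_of_subset hP, card_range]
  rw [hcard, ← add_sum_erase _ _ (empty_mem_powerset (range (L + 1)))]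
  have herr : |∑ A ∈ (range (L + 1)).powerset.erase ∅,
      ((∏ t ∈ A, e t) * ∏ t ∈ range (L + 1) \ A, c t) *
        ∑ y ∈ range (q - L), ∏ t ∈ A, fsub q R (y + t)| ≤ 2 ^ (L + 1) * C := by
    calc _ ≤ ∑ A ∈ (range (L + 1)).powerset.erase ∅, C := by
          refine (abs_sum_le_sum_abs _ _).trans (sum_le_sum fun A hA ↦ ?_)
          rw [mem_erase, mem_powerset] at hA
          rw [abs_mul, abs_mul, abs_prod, abs_prod]
          have hA1 : ∏ t ∈ A, |e t| ≤ 1 := prod_le_one (fun _ _ ↦ abs_nonneg _) fun _ _ ↦ he _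
          have hA2 : ∏ t ∈ range (L + 1) \ A, |c t| ≤ 1 :=
            prod_le_one (fun _ _ ↦ abs_nonneg _) fun _ _ ↦ hc0 _
          refine (mul_le_of_le_one_left (abs_nonneg _) ?_).trans
            (hC A hA.2 (nonempty_iff_ne_empty.2 hA.1))
          exact mul_le_one₀ hA1 (prod_nonneg fun _ _ ↦ abs_nonneg _) hA2
      _ ≤ ∑ A ∈ (range (L + 1)).powerset, C :=
          sum_le_sum_of_subset_of_nonneg (erase_subset _ _) fun _ _ _ ↦ hC0
      _ = 2 ^ (L + 1) * C := by simp
  have hcast : ((q - L : ℕ) : ℝ) = (q : ℝ) - L := Nat.cast_sub hL.le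
  have := (abs_le.1 herr).1
  simp only [prod_empty, sdiff_empty, one_mul, sum_const, card_range, nsmul_eq_mul, mul_one,
    hmain, hcast]
  linarith

/-- An exact match of the pattern `p 0 < p 1 < ⋯ < p ℓ` at `x n` is a run of prescribed gaps. -/
theorem apply_add_eq_of_pattern {T ℓ n : ℕ} {x p : ℕ → ℕ}
    (hx : ∀ i j, i < j → j < T → x i < x j) (hp : StrictMono p) (hp0 : p 0 = 0) (hn : n < T)
    (h : ∀ t ∈ range (p ℓ + 1),
      (x n + t ∈ (range T).image x ↔ t ∈ (range (ℓ + 1)).image p)) :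
    ∀ j ≤ ℓ, n + j < T ∧ x (n + j) = x n + p j := by
  have hlt : ∀ i j, i < T → x i < x j → i < j := fun i j hi hij ↦ by
    rcases lt_trichotomy i j with h | h | h
    · exact h
    · subst h; omega
    · have := hx j i h hi; omega
  intro j
  induction j with
  | zero => simp [hn, hp0]
  | succ j ih =>
    intro hj
    obtain ⟨hT, hxj⟩ := ih (by omega)
    have hpj : p j < p (j + 1) := hp (by omega)
    have hpl : p (j + 1) ≤ p ℓ := hp.monotone hj
    have hmem := (h (p (j + 1)) (by rw [mem_range]; omega)).2
      (mem_image_of_mem _ (by rw [mem_range]; omega))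
    obtain ⟨m, hm, hxm⟩ := mem_image.1 hmem
    have hmT := mem_range.1 hm
    have hjm : n + j < m := hlt _ _ hT (by omega)
    rcases (show n + (j + 1) = m ∨ n + (j + 1) < m by omega) with rfl | hlt'
    · exact ⟨hmT, hxm⟩
    · exfalso
      have h1 := hx (n + j) (n + (j + 1)) (by omega) (by omega)
      have h2 := hx _ _ hlt' hmT
      have h3 := (h (x (n + (j + 1)) - x n) (by rw [mem_range]; omega)).1
        (mem_image.2 ⟨n + (j + 1), by rw [mem_range]; omega, by omega⟩)
      obtain ⟨i, -, hpi⟩ := mem_image.1 h3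
      have h4 : j < i := hp.lt_iff_lt.1 (by omega)
      have h5 : i < j + 1 := hp.lt_iff_lt.1 (by omega)
      omega

theorem card_filter_pattern_le {T ℓ m : ℕ} {x p : ℕ → ℕ}
    (hx : ∀ i j, i < j → j < T → x i < x j) (hp : StrictMono p) (hp0 : p 0 = 0) :
    ((range m).filter fun y ↦ ∀ t ∈ range (p ℓ + 1),
      (y + t ∈ (range T).image x ↔ t ∈ (range (ℓ + 1)).image p)).card ≤
    ((range (T - ℓ)).filter fun n ↦ ∀ i < ℓ,
      x (n + i + 1) - x (n + i) = p (i + 1) - p i).card := by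
  refine (card_le_card fun y hy ↦ ?_).trans (card_image_le (f := x))
  obtain ⟨-, hy⟩ := mem_filter.1 hy
  have h0 : y + 0 ∈ (range T).image x :=
    (hy 0 (by simp)).2 (mem_image.2 ⟨0, by simp, hp0⟩)
  obtain ⟨n, hn, rfl⟩ := mem_image.1 h0
  have key := apply_add_eq_of_pattern hx hp hp0 (mem_range.1 hn) hy
  refine mem_image.2 ⟨n, mem_filter.2 ⟨?_, fun i hi ↦ ?_⟩, rfl⟩
  · have := (key ℓ le_rfl).1
    rw [mem_range]; omega
  · have h1 := (key i hi.le).2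
    have h2 := (key (i + 1) hi).2
    rw [← add_assoc] at h2
    omega

theorem le_card_filter_gaps {T ℓ q L : ℕ} {x : ℕ → ℕ} {C : ℝ}
    (hx : ∀ i j, i < j → j < T → x i < x j) (hTq : T ≤ q) (hL : L < q)
    (hC : ∀ m, 1 ≤ m → m ≤ q → ∀ A ⊆ range (L + 1), A.Nonempty →
      |∑ n ∈ range m, ∏ t ∈ A, fsub q ((range T).image x) (n + t)| ≤ C)
    {g : ℕ → ℕ} (hg : ∀ i, 1 ≤ g i) (hgL : ∑ i ∈ range ℓ, g i ≤ L) :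
    ((q : ℝ) - L) * (T / q) * ∏ i ∈ range ℓ, (((T : ℝ) / q) * (1 - (T : ℝ) / q) ^ (g i - 1))
        - 2 ^ (L + 1) * C ≤
      ((range (T - ℓ)).filter fun n ↦ ∀ i < ℓ, x (n + i + 1) - x (n + i) = g i).card := by
  set p : ℕ → ℕ := fun j ↦ ∑ i ∈ range j, g i with hp
  have hps : ∀ j, p (j + 1) = p j + g j := fun j ↦ sum_range_succ _ _
  have hpm : StrictMono p := strictMono_nat_of_lt_succ fun j ↦ by
    have := hg j
    rw [hps]; omega
  have hinj : Set.InjOn x (range T) := fun i hi j hj hij ↦ by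
    rw [coe_range, Set.mem_Iio] at hi hj
    rcases lt_trichotomy i j with h | h | h
    · have := hx i j h hj; omega
    · exact h
    · have := hx j i h hi; omega
  have hcard : ((range T).image x).card = T := by
    rw [card_image_of_injOn hinj, card_range]
  have hPcard : ((range (ℓ + 1)).image p).card = ℓ + 1 := by
    rw [card_image_of_injective _ hpm.injective, card_range]
  have hpL : p ℓ ≤ L := hgL
  have hδ1 : (T : ℝ) / q ≤ 1 := div_le_one_of_le₀ (by exact_mod_cast hTq) (by positivity)
  have hC0 : 0 ≤ C := (abs_nonneg _).trans (hC 1 le_rfl (by omega) {0} (by simp) (by simp))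
  have key := le_card_filter_pattern (q := q) (L := p ℓ) (R := (range T).image x)
    (P := (range (ℓ + 1)).image p) (C := C) (by rw [hcard]; exact hTq) (by omega)
    (by
      intro t ht
      obtain ⟨i, hi, rfl⟩ := mem_image.1 ht
      rw [mem_range] at hi ⊢
      have := hpm.monotone (Nat.lt_succ_iff.1 hi)
      omega)
    (fun A hA hAn ↦ hC _ (by omega) (by omega) A
      (hA.trans (range_subset_range.2 (by omega))) hAn)
  rw [hcard, hPcard] at key
  have hle := card_filter_pattern_le (T := T) (ℓ := ℓ) (m := q - p ℓ) hx hpm (by simp [hp])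
  simp only [hps, Nat.add_sub_cancel_left] at hle
  have hexp : p ℓ + 1 - (ℓ + 1) = ∑ i ∈ range ℓ, (g i - 1) := by
    have h1 : ∑ i ∈ range ℓ, (g i - 1) + ℓ = p ℓ := by
      calc _ = ∑ i ∈ range ℓ, (g i - 1 + 1) := by simp [sum_add_distrib]
        _ = p ℓ := sum_congr rfl fun i _ ↦ Nat.sub_add_cancel (hg i)
    omega
  rw [hexp, ← prod_pow_eq_pow_sum] at key
  rw [prod_mul_distrib, prod_const, card_range]
  have hpLr : (p ℓ : ℝ) ≤ L := by exact_mod_cast hpL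
  have hprod : 0 ≤ ∏ i ∈ range ℓ, (1 - (T : ℝ) / q) ^ (g i - 1) :=
    prod_nonneg fun i _ ↦ pow_nonneg (by linarith) _
  calc _ = ((q : ℝ) - L) * (((T : ℝ) / q) ^ (ℓ + 1) *
          ∏ i ∈ range ℓ, (1 - (T : ℝ) / q) ^ (g i - 1)) - 2 ^ (L + 1) * C := by ring
    _ ≤ ((q : ℝ) - p ℓ) * (((T : ℝ) / q) ^ (ℓ + 1) *
          ∏ i ∈ range ℓ, (1 - (T : ℝ) / q) ^ (g i - 1)) - 2 ^ (p ℓ + 1) * C := by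
        gcongr
        norm_num
    _ ≤ _ := key
    _ ≤ _ := by exact_mod_cast hle

theorem le_card_filter_gaps_mod {M ℓ J T q : ℕ} {x : ℕ → ℕ} {a : Fin ℓ → ℕ} {C : ℝ}
    (hM : 0 < M) (ha : ∀ i, 1 ≤ a i ∧ a i ≤ M)
    (hx : ∀ i j, i < j → j < T → x i < x j) (hTq : T ≤ q) (hL : ℓ * M * J < q)
    (hC : ∀ m, 1 ≤ m → m ≤ q → ∀ A ⊆ range (ℓ * M * J + 1), A.Nonempty →
      |∑ n ∈ range m, ∏ t ∈ A, fsub q ((range T).image x) (n + t)| ≤ C) :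
    ((q : ℝ) - (ℓ * M * J : ℕ)) * (T / q) *
        ∏ i, ∑ j ∈ range J, (((T : ℝ) / q) * (1 - (T : ℝ) / q) ^ (a i + M * j - 1))
        - J ^ ℓ * (2 ^ (ℓ * M * J + 1) * C) ≤
      ((range (T - ℓ)).filter fun n ↦ ∀ i : Fin ℓ,
        (x (n + (i : ℕ) + 1) - x (n + (i : ℕ))) % M = a i % M).card := by
  classical
  let F : (Fin ℓ → ℕ) → Finset ℕ := fun c ↦ (range (T - ℓ)).filter fun n ↦ ∀ i : Fin ℓ,
    x (n + (i : ℕ) + 1) - x (n + (i : ℕ)) = a i + M * c i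
  let B : Finset (Fin ℓ → ℕ) := Fintype.piFinset fun _ ↦ range J
  have hdisj : (B : Set (Fin ℓ → ℕ)).PairwiseDisjoint F := by
    intro c _ d _ hcd
    refine disjoint_left.2 fun n hn hn' ↦ hcd (funext fun i ↦ ?_)
    have h1 := (mem_filter.1 hn).2 i
    have h2 := (mem_filter.1 hn').2 i
    exact Nat.eq_of_mul_eq_mul_left hM (by omega)
  have hsub : B.biUnion F ⊆ (range (T - ℓ)).filter fun n ↦ ∀ i : Fin ℓ,
      (x (n + (i : ℕ) + 1) - x (n + (i : ℕ))) % M = a i % M := by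
    intro n hn
    obtain ⟨c, -, hc⟩ := mem_biUnion.1 hn
    obtain ⟨h1, h2⟩ := mem_filter.1 hc
    refine mem_filter.2 ⟨h1, fun i ↦ ?_⟩
    rw [h2 i, Nat.add_mul_mod_self_left]
  have hcard := card_le_card hsub
  rw [card_biUnion hdisj] at hcard
  have hF : ∀ c ∈ B, ((q : ℝ) - (ℓ * M * J : ℕ)) * (T / q) *
      ∏ i, (((T : ℝ) / q) * (1 - (T : ℝ) / q) ^ (a i + M * c i - 1))
      - 2 ^ (ℓ * M * J + 1) * C ≤ (F c).card := by
    intro c hc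
    let g : ℕ → ℕ := fun i ↦ if h : i < ℓ then a ⟨i, h⟩ + M * c ⟨i, h⟩ else 1
    have hgi : ∀ i : Fin ℓ, g i = a i + M * c i := fun i ↦ by simp [g]
    have hg : ∀ i, 1 ≤ g i := fun i ↦ by
      simp only [g]
      split_ifs with h
      · have := (ha ⟨i, h⟩).1
        omega
      · exact le_rfl
    have hgL : ∑ i ∈ range ℓ, g i ≤ ℓ * M * J := by
      rw [Finset.sum_range]
      calc ∑ i : Fin ℓ, g i ≤ ∑ i : Fin ℓ, M * J := sum_le_sum fun i _ ↦ by
            rw [hgi]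
            have h1 : c i < J := mem_range.1 (Fintype.mem_piFinset.1 hc i)
            have h2 : M * (c i + 1) ≤ M * J := Nat.mul_le_mul_left _ h1
            have := (ha i).2
            rw [mul_add] at h2
            omega
        _ = ℓ * M * J := by simp [mul_assoc]
    have := le_card_filter_gaps hx hTq hL hC hg hgL
    rw [Finset.prod_range] at this
    simp only [hgi] at this
    refine this.trans (Nat.cast_le.2 (card_le_card fun n hn ↦ ?_))
    obtain ⟨h1, h2⟩ := mem_filter.1 hn
    exact mem_filter.2 ⟨h1, fun i ↦ (h2 i i.2).trans (hgi i)⟩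
  have hsum := sum_le_sum hF
  rw [sum_sub_distrib, ← mul_sum, sum_const, Fintype.card_piFinset_const, card_range,
    nsmul_eq_mul] at hsum
  rw [prod_univ_sum]
  refine le_trans ?_ (hsum.trans ?_)
  · simp [B]
  · exact_mod_cast hcard

theorem tendsto_mul_geom_sum_arith {α : Type*} {l : Filter α} {δ : α → ℝ} {J : α → ℕ} {a M : ℕ}
    (hM : 0 < M) (ha : 1 ≤ a) (hpos : ∀ᶠ q in l, 0 < δ q) (hδ : Tendsto δ l (nhds 0))
    (hJ : Tendsto (fun q ↦ δ q * J q) l atTop) :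
    Tendsto (fun q ↦ ∑ j ∈ range (J q), δ q * (1 - δ q) ^ (a + M * j - 1)) l
      (nhds (1 / (M : ℝ))) := by
  have h1 : Tendsto (fun q ↦ 1 - δ q) l (nhds 1) := by simpa using hδ.const_sub 1
  have hlt : ∀ᶠ q in l, δ q < 1 := hδ.eventually (gt_mem_nhds one_pos)
  have hden : Tendsto (fun q ↦ ∑ i ∈ range M, (1 - δ q) ^ i) l (nhds M) := by
    simpa using tendsto_finsetSum (range M) fun i _ ↦ h1.pow i
  have htail : Tendsto (fun q ↦ (1 - δ q) ^ (M * J q)) l (nhds 0) := by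
    refine squeeze_zero' ?_ ?_ (Real.tendsto_exp_neg_atTop_nhds_zero.comp hJ)
    · filter_upwards [hlt] with q hq
      exact pow_nonneg (by linarith) _
    · filter_upwards [hpos, hlt] with q h0 hq
      calc (1 - δ q) ^ (M * J q) ≤ (1 - δ q) ^ J q :=
            pow_le_pow_of_le_one (by linarith) (by linarith) (Nat.le_mul_of_pos_left _ hM)
        _ ≤ Real.exp (-δ q) ^ J q :=
            pow_le_pow_left₀ (by linarith) (Real.one_sub_le_exp_neg _) _
        _ = Real.exp (-(δ q * J q)) := by
            rw [← Real.exp_nat_mul]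
            congr 1
            ring
  have hlim : Tendsto (fun q ↦ (1 - δ q) ^ (a - 1) *
      ((1 - (1 - δ q) ^ (M * J q)) / ∑ i ∈ range M, (1 - δ q) ^ i)) l (nhds (1 / (M : ℝ))) := by
    have := (h1.pow (a - 1)).mul ((htail.const_sub 1).div hden (by positivity))
    simpa using this
  refine hlim.congr' ?_
  filter_upwards [hpos, hlt] with q h0 hq
  have hG : 0 < ∑ i ∈ range M, (1 - δ q) ^ i :=
    sum_pos (fun i _ ↦ pow_pos (by linarith) _) (nonempty_range_iff.2 hM.ne')
  have e1 := geom_sum_mul_neg (1 - δ q) M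
  have e2 := geom_sum_mul_neg ((1 - δ q) ^ M) (J q)
  rw [← e1, ← pow_mul] at e2
  rw [← e2]
  have e3 : ∑ j ∈ range (J q), δ q * (1 - δ q) ^ (a + M * j - 1) =
      δ q * (1 - δ q) ^ (a - 1) * ∑ j ∈ range (J q), ((1 - δ q) ^ M) ^ j := by
    rw [mul_sum]
    refine sum_congr rfl fun j _ ↦ ?_
    rw [show a + M * j - 1 = (a - 1) + M * j by omega, pow_add, pow_mul]
    ring
  rw [e3]
  field_simp
  ring

theorem tendsto_of_sum_le {α ι : Type*} [DecidableEq ι] {l : Filter α} {s : Finset ι}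
    {f g : ι → α → ℝ} {c : ι → ℝ} (hg : ∀ i ∈ s, Tendsto (g i) l (nhds (c i)))
    (hgf : ∀ i ∈ s, ∀ᶠ q in l, g i q ≤ f i q)
    (hf : ∀ᶠ q in l, ∑ i ∈ s, f i q ≤ ∑ i ∈ s, c i) {i : ι} (hi : i ∈ s) :
    Tendsto (f i) l (nhds (c i)) := by
  have hup : Tendsto (fun q ↦ ∑ i ∈ s, c i - ∑ j ∈ s.erase i, g j q) l (nhds (c i)) := by
    have := (tendsto_finsetSum (s.erase i) fun j hj ↦ hg j (mem_of_mem_erase hj)).const_sub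
      (∑ i ∈ s, c i)
    rwa [← add_sum_erase s c hi, add_sub_cancel_right, add_sum_erase s c hi] at this
  refine tendsto_of_tendsto_of_tendsto_of_le_of_le' (hg i hi) hup (hgf i hi) ?_
  have hall : ∀ᶠ q in l, ∀ j ∈ s, g j q ≤ f j q := (eventually_all_finset s).2 hgf
  filter_upwards [hf, hall] with q hq hq'
  have h1 := sum_le_sum fun j (hj : j ∈ s.erase i) ↦ hq' j (mem_of_mem_erase hj)
  rw [← add_sum_erase s (fun j ↦ f j q) hi] at hq
  linarith

theorem eq_of_mod_eq_of_mem_Icc {M a b : ℕ} (ha : a ∈ Icc 1 M) (hb : b ∈ Icc 1 M)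
    (h : a % M = b % M) : a = b := by
  rw [mem_Icc] at ha hb
  rcases ha.2.lt_or_eq with h1 | h1 <;> rcases hb.2.lt_or_eq with h2 | h2
  · rwa [Nat.mod_eq_of_lt h1, Nat.mod_eq_of_lt h2] at h
  · rw [Nat.mod_eq_of_lt h1, h2, Nat.mod_self] at h; omega
  · rw [Nat.mod_eq_of_lt h2, h1, Nat.mod_self] at h; omega
  · omega

theorem sum_card_filter_mod_le {ℓ M m : ℕ} (d : ℕ → Fin ℓ → ℕ) :
    ∑ a ∈ Fintype.piFinset fun _ : Fin ℓ ↦ Icc 1 M,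
      ((range m).filter fun n ↦ ∀ i, d n i % M = a i % M).card ≤ m := by
  classical
  rw [← card_biUnion]
  · exact (card_le_card (biUnion_subset.2 fun a _ ↦ filter_subset _ _)).trans
      (card_range m).le
  · intro a ha b hb hab
    refine disjoint_left.2 fun n hn hn' ↦ hab (funext fun i ↦ ?_)
    exact eq_of_mod_eq_of_mem_Icc (Fintype.mem_piFinset.1 ha i) (Fintype.mem_piFinset.1 hb i)
      (((mem_filter.1 hn).2 i).symm.trans ((mem_filter.1 hn').2 i))

theorem eventually_mul_two_rpow_le_exp :
    ∀ᶠ y : ℝ in atTop, y * (2 : ℝ) ^ y ≤ Real.exp y := by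
  have hb : 0 < 1 - Real.log 2 := by linarith [Real.log_two_lt_d9]
  filter_upwards [(tendsto_rpow_mul_exp_neg_mul_atTop_nhds_zero 1 _ hb).eventually
    (gt_mem_nhds one_pos)] with y hy
  rw [Real.rpow_one] at hy
  calc y * (2 : ℝ) ^ y = y * Real.exp (-(1 - Real.log 2) * y) * Real.exp y := by
        rw [Real.rpow_def_of_pos two_pos, mul_assoc, ← Real.exp_add]
        ring_nf
    _ ≤ 1 * Real.exp y := by gcongr
    _ = Real.exp y := one_mul _

theorem pow_mul_two_pow_le_exp_pow {y : ℝ} {J ℓ M : ℕ} (hM : 1 ≤ M) (hℓ : 1 ≤ ℓ) (hy : 1 ≤ y)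
    (hJ : (J : ℝ) + 1 ≤ y) (h : y * (2 : ℝ) ^ y ≤ Real.exp y) :
    (J : ℝ) ^ ℓ * 2 ^ (ℓ * M * J + 1) ≤ Real.exp y ^ (ℓ * M) := by
  have h2 : (2 : ℝ) ^ (J + 1) ≤ 2 ^ y := by
    rw [← Real.rpow_natCast]
    exact Real.rpow_le_rpow_of_exponent_le one_le_two (by exact_mod_cast hJ)
  have hlm : 1 ≤ ℓ * M := Nat.mul_pos hℓ hM
  calc (J : ℝ) ^ ℓ * 2 ^ (ℓ * M * J + 1) ≤ y ^ ℓ * 2 ^ (ℓ * M * J + ℓ * M) := by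
        gcongr
        · linarith
        · norm_num
    _ ≤ y ^ (ℓ * M) * (2 ^ (J + 1)) ^ (ℓ * M) := by
        rw [← pow_mul]
        gcongr
        · exact Nat.le_mul_of_pos_right _ hM
        · norm_num
        · exact le_of_eq (by ring)
    _ ≤ y ^ (ℓ * M) * (2 ^ y) ^ (ℓ * M) := by gcongr
    _ ≤ Real.exp y ^ (ℓ * M) := by
        rw [← mul_pow]
        gcongr

theorem tendsto_log_log_natCast_atTop :
    Tendsto (fun q : ℕ ↦ Real.log (Real.log q)) atTop atTop :=
  Real.tendsto_log_atTop.comp (Real.tendsto_log_atTop.comp tendsto_natCast_atTop_atTop)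

theorem tendsto_log_log_natCast_div_self :
    Tendsto (fun q : ℕ ↦ Real.log (Real.log q) / q) atTop (nhds 0) := by
  have h : Tendsto (fun q : ℕ ↦ Real.log q / q) atTop (nhds 0) :=
    Real.isLittleO_log_id_atTop.tendsto_div_nhds_zero.comp tendsto_natCast_atTop_atTop
  refine squeeze_zero' ?_ ?_ h
  · filter_upwards [tendsto_log_log_natCast_atTop.eventually_ge_atTop 0] with q hq
    positivity
  · filter_upwards [eventually_ge_atTop 1] with q hq
    have : 0 ≤ Real.log q := Real.log_natCast_nonneg q
    exact div_le_div_of_nonneg_right (Real.log_le_self this) (Nat.cast_nonneg q)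

theorem statement6 (M ℓ : ℕ) (hM : 2 ≤ M) (hℓ : 1 ≤ ℓ)
    (T : ℕ → ℕ) (x : ℕ → ℕ → ℕ)
    (hmono : ∀ q i j, i < j → j < T q → x q i < x q j)
    (hrange : ∀ q i, i < T q → x q i < q)
    (hupper : ∀ q, T q ≤ q)
    (hlower : ∀ᶠ q : ℕ in Filter.atTop,
      Real.log (Real.log (Real.log q)) / Real.log (Real.log q) * q ≤ (T q : ℝ))
    (hTsmall : Filter.Tendsto (fun q : ℕ => (T q : ℝ) / q) Filter.atTop (nhds 0))
    (hC : Filter.Tendsto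
      (fun q : ℕ => corrMeasure ((Finset.range (T q)).image (x q)) q
          (⌊(ℓ : ℝ) * M * Real.log (Real.log q)⌋₊) * Real.log q ^ (ℓ * M) / T q)
      Filter.atTop (nhds 0)) :
    ∀ a : Fin ℓ → ℕ, (∀ i, 1 ≤ a i ∧ a i ≤ M) →
      Filter.Tendsto
        (fun q : ℕ => (((Finset.range (T q - ℓ)).filter
            (fun n => ∀ i : Fin ℓ,
              (x q (n + (i : ℕ) + 1) - x q (n + (i : ℕ))) % M = a i % M)).card : ℝ) / T q)
        Filter.atTop (nhds (1 / (M : ℝ) ^ ℓ)) := by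
  set y : ℕ → ℝ := fun q ↦ Real.log (Real.log q) with hy
  let C : ℕ → ℝ := fun q ↦
    corrMeasure ((range (T q)).image (x q)) q ⌊(ℓ : ℝ) * M * y q⌋₊
  let J : ℕ → ℕ := fun q ↦ ⌊y q⌋₊ - 1
  have hyt : Tendsto y atTop atTop := tendsto_log_log_natCast_atTop
  have hJle : ∀ᶠ q in atTop, (J q : ℝ) + 1 ≤ y q := by
    filter_upwards [hyt.eventually_ge_atTop 1] with q hq
    have h1 : 1 ≤ ⌊y q⌋₊ := Nat.one_le_floor_iff _ |>.2 hq
    simp only [J]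
    rw [Nat.cast_sub h1]
    simpa using Nat.floor_le (by linarith)
  have hJge : ∀ᶠ q in atTop, y q / 2 ≤ J q := by
    filter_upwards [hyt.eventually_ge_atTop 4] with q hq
    have h1 : 1 ≤ ⌊y q⌋₊ := Nat.one_le_floor_iff _ |>.2 (by linarith)
    have h2 := Nat.lt_floor_add_one (y q)
    simp only [J]
    rw [Nat.cast_sub h1]
    push_cast
    linarith
  have hTpos : ∀ᶠ q in atTop, 0 < T q := by
    filter_upwards [hlower, hyt.eventually_gt_atTop 1, eventually_gt_atTop 0] with q h1 h2 h3
    have h4 : 0 < Real.log (y q) := Real.log_pos h2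
    have h5 : (0 : ℝ) < q := by exact_mod_cast h3
    have h6 : 0 < Real.log (y q) / y q * q := by positivity
    exact_mod_cast h6.trans_le h1
  have hδpos : ∀ᶠ q : ℕ in atTop, (0 : ℝ) < T q / q := by
    filter_upwards [hTpos, eventually_gt_atTop 0] with q h1 h2
    positivity
  have hδJ : Tendsto (fun q : ℕ ↦ (T q : ℝ) / q * J q) atTop atTop := by
    refine tendsto_atTop_mono' _ ?_
      ((Real.tendsto_log_atTop.comp hyt).atTop_div_const (two_pos : (0 : ℝ) < 2))
    filter_upwards [hlower, hJge, hyt.eventually_gt_atTop 1, eventually_gt_atTop 0]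
      with q h1 h2 h3 h4
    have h5 : 0 < Real.log (y q) := Real.log_pos h3
    have h6 : (0 : ℝ) < q := by exact_mod_cast h4
    have h7 : Real.log (y q) / y q ≤ T q / q := (le_div_iff₀ h6).2 h1
    have h8 : 0 < y q := by linarith
    calc Real.log (y q) / 2 = Real.log (y q) / y q * (y q / 2) := by field_simp
      _ ≤ T q / q * J q := by gcongr
  have hs : ∀ᶠ q : ℕ in atTop, ⌊(ℓ : ℝ) * M * y q⌋₊ ≤ q := by
    have h := tendsto_log_log_natCast_div_self.const_mul ((ℓ : ℝ) * M)
    rw [mul_zero] at h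
    filter_upwards [h.eventually (gt_mem_nhds one_pos), eventually_gt_atTop 0] with q h1 h2
    have h3 : (0 : ℝ) < q := by exact_mod_cast h2
    rw [← mul_div_assoc, div_lt_one h3] at h1
    exact Nat.floor_le_of_le h1.le
  have hLs : ∀ᶠ q in atTop, ℓ * M * J q + 1 ≤ ⌊(ℓ : ℝ) * M * y q⌋₊ := by
    filter_upwards [hJle] with q hq
    refine Nat.le_floor ?_
    have h1 : (1 : ℝ) ≤ ℓ * M := by exact_mod_cast Nat.mul_pos hℓ (by omega)
    push_cast
    calc (ℓ : ℝ) * M * J q + 1 ≤ ℓ * M * (J q + 1) := by linarith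
      _ ≤ ℓ * M * y q := by gcongr
  have hLq : Tendsto (fun q : ℕ ↦ ((ℓ * M * J q : ℕ) : ℝ) / q) atTop (nhds 0) := by
    have h := tendsto_log_log_natCast_div_self.const_mul ((ℓ : ℝ) * M)
    rw [mul_zero] at h
    refine squeeze_zero' (Eventually.of_forall fun q ↦ by positivity) ?_ h
    filter_upwards [hJle] with q hq
    rw [← mul_div_assoc]
    push_cast
    gcongr
    linarith
  have herr : Tendsto (fun q ↦ (J q : ℝ) ^ ℓ * (2 ^ (ℓ * M * J q + 1) * C q) / T q)
      atTop (nhds 0) := by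
    have hb := bdd_le_mul_tendsto_zero' (f := fun q ↦
      (J q : ℝ) ^ ℓ * 2 ^ (ℓ * M * J q + 1) / Real.log q ^ (ℓ * M)) 1 ?_ hC
    · refine hb.congr' ?_
      filter_upwards [hyt.eventually_gt_atTop 0] with q hq
      have hlog : Real.log q ≠ 0 := by
        intro h
        simp [hy, h] at hq
      simp only [C, y]
      field_simp
    · filter_upwards [hJle, hyt.eventually_ge_atTop 1,
        hyt.eventually eventually_mul_two_rpow_le_exp,
        (Real.tendsto_log_atTop.comp tendsto_natCast_atTop_atTop).eventually_gt_atTop 0]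
        with q h1 h2 h3 h4
      have h4' : 0 < Real.log q := h4
      have h5 := pow_mul_two_pow_le_exp_pow (by omega : 1 ≤ M) hℓ h2 h1 h3
      rw [hy, Real.exp_log h4'] at h5
      rw [abs_of_nonneg (by positivity)]
      exact div_le_one_of_le₀ h5 (by positivity)
  let N : (Fin ℓ → ℕ) → ℕ → ℝ := fun a q ↦ (((range (T q - ℓ)).filter fun n ↦ ∀ i : Fin ℓ,
    (x q (n + (i : ℕ) + 1) - x q (n + (i : ℕ))) % M = a i % M).card : ℝ) / T q
  let G : (Fin ℓ → ℕ) → ℕ → ℝ := fun a q ↦ (1 - ((ℓ * M * J q : ℕ) : ℝ) / q) *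
      ∏ i, ∑ j ∈ range (J q), (((T q : ℝ) / q) * (1 - (T q : ℝ) / q) ^ (a i + M * j - 1)) -
    (J q : ℝ) ^ ℓ * (2 ^ (ℓ * M * J q + 1) * C q) / T q
  intro a ha
  refine tendsto_of_sum_le (s := Fintype.piFinset fun _ : Fin ℓ ↦ Icc 1 M) (f := N) (g := G)
    (c := fun _ ↦ 1 / (M : ℝ) ^ ℓ) ?_ ?_ ?_ (Fintype.mem_piFinset.2 fun i ↦ mem_Icc.2 (ha i))
  · intro b hb
    have h := tendsto_finsetProd univ fun i (_ : i ∈ univ) ↦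
      tendsto_mul_geom_sum_arith (a := b i) (by omega : 0 < M)
        (mem_Icc.1 (Fintype.mem_piFinset.1 hb i)).1 hδpos hTsmall hδJ
    simpa [G] using ((hLq.const_sub 1).mul h).sub herr
  · intro b hb
    filter_upwards [hs, hLs, hTpos, eventually_gt_atTop 0] with q h1 h2 h3 h4
    have h5 := le_card_filter_gaps_mod (C := C q) (by omega : 0 < M)
      (fun i ↦ mem_Icc.1 (Fintype.mem_piFinset.1 hb i)) (hmono q) (hupper q)
      (J := J q) (by omega) fun m hm hmq A hA hAn ↦
        abs_sum_prod_fsub_le_corrMeasure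
          ((card_image_le.trans (card_range _).le).trans (hupper q)) h1 hAn
          (hA.trans (range_subset_range.2 h2)) hm hmq
    have hT : (0 : ℝ) < T q := by exact_mod_cast h3
    have hq : (0 : ℝ) < q := by exact_mod_cast h4
    refine le_trans (le_of_eq ?_) (div_le_div_of_nonneg_right h5 hT.le)
    simp only [G]
    field_simp
  · filter_upwards [hTpos] with q hq
    have hT : (0 : ℝ) < T q := by exact_mod_cast hq
    have h := sum_card_filter_mod_le (M := M) (m := T q - ℓ)
      fun n (i : Fin ℓ) ↦ x q (n + (i : ℕ) + 1) - x q (n + (i : ℕ))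
    have h' : _ ≤ T q := h.trans (Nat.sub_le _ _)
    simp only [N]
    rw [← sum_div, sum_const, Fintype.card_piFinset_const, Nat.card_Icc, nsmul_eq_mul,
      Nat.add_sub_cancel, Nat.cast_pow, mul_one_div_cancel (by positivity), div_le_one hT]
    exact_mod_cast h'
end

section
/- Let p ≥ 2 be a prime, d a divisor of p−1, and f ∈ Z_p[x] a non-constant polynomial with no multiple roots in the algebraic closure of Z_p. Define R = { n : 0 ≤ n ≤ p−1, there exists y ∈ Z_p^* with f(n) ≡ y^d (mod p) }, and let m ≤ deg(f) be the number of zeros of f in Z_p. Then | |R| − (p−m)/d | ≤ ((d−1)/d)·(deg(f) − 1)·p^{1/2}. -/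
open Finset Filter

section Stepanov

open Polynomial

/-- Products `X ^ τ i * v i` with distinct `τ i` and `v i` not vanishing at `0` are linearly
independent. -/
theorem sum_C_mul_X_pow_mul_ne_zero {K ι : Type*} [Field K] [Fintype ι] {τ : ι → ℕ}
    (hτ : Function.Injective τ) {v : ι → K[X]} (hv : ∀ i, (v i).coeff 0 ≠ 0) {a : ι → K}
    (ha : a ≠ 0) : ∑ i, C (a i) * (X ^ τ i * v i) ≠ 0 := by
  classical
  obtain ⟨j, hj⟩ := Function.ne_iff.mp ha
  obtain ⟨m, hm, hmin⟩ := Finset.exists_min_image (univ.filter fun i => a i ≠ 0) τ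
    ⟨j, by simpa using hj⟩
  simp only [mem_filter, mem_univ, true_and] at hm hmin
  intro h
  have h1 := congrArg (fun g => g.coeff (τ m)) h
  simp only [finsetSum_coeff, coeff_C_mul, coeff_zero] at h1
  rw [Finset.sum_eq_single m] at h1
  · rw [coeff_X_pow_mul'] at h1
    simp [hm, hv] at h1
  · intro i _ him
    by_cases hi : a i = 0
    · simp [hi]
    · rw [coeff_X_pow_mul', if_neg, mul_zero]
      have := hmin i hi
      have : τ i ≠ τ m := fun h => him (hτ h)
      omega
  · simp

/-- A family of more than `B` polynomials of degree less than `B` is linearly dependent. -/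
theorem exists_ne_zero_sum_C_mul_eq_zero {K ι : Type*} [Field K] [Fintype ι] {B : ℕ}
    (hB : B < Fintype.card ι) {g : ι → K[X]} (hg : ∀ i, (g i).degree < B) :
    ∃ a : ι → K, a ≠ 0 ∧ ∑ i, C (a i) * g i = 0 := by
  have hdep : ¬ LinearIndependent K (fun i => (⟨g i, mem_degreeLT.mpr (hg i)⟩ : degreeLT K B)) := by
    intro h
    have := h.fintype_card_le_finrank
    rw [(degreeLTEquiv K B).finrank_eq] at this
    simp at this
    omega
  rw [Fintype.not_linearIndependent_iff] at hdep
  obtain ⟨a, h1, j, hj⟩ := hdep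
  refine ⟨a, fun h => hj (by simp [h]), ?_⟩
  have := congrArg Subtype.val h1
  simpa [smul_eq_C_mul] using this

theorem injective_mixed_radix {e R Q k : ℕ} (hQ : Q = e * R + 1) :
    Function.Injective (fun t : Fin k × Fin e × Fin R =>
      (t.2.2 : ℕ) + (t.2.1 : ℕ) * R + (t.1 : ℕ) * Q) := by
  rintro ⟨a, b, c⟩ ⟨a', b', c'⟩ h
  simp only at h
  have hb : ∀ (b : Fin e) (c : Fin R), (c : ℕ) + b * R < Q := by
    intro b c
    have := c.2
    have : ((b : ℕ) + 1) * R ≤ e * R := Nat.mul_le_mul_right _ b.2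
    nlinarith
  have hQ0 : 0 < Q := by omega
  have hR : 0 < R := c.pos
  have h1 := congrArg (· / Q) h
  have h2 := congrArg (· % Q) h
  simp only [Nat.add_mul_div_right _ _ hQ0, Nat.add_mul_mod_self_right,
    Nat.div_eq_of_lt (hb _ _), Nat.mod_eq_of_lt (hb _ _)] at h1 h2
  have h3 := congrArg (· / R) h2
  have h4 := congrArg (· % R) h2
  simp only [Nat.add_mul_div_right _ _ hR, Nat.add_mul_mod_self_right,
    Nat.div_eq_of_lt c.2, Nat.div_eq_of_lt c'.2, Nat.mod_eq_of_lt c.2,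
    Nat.mod_eq_of_lt c'.2] at h3 h4
  ext <;> simp <;> omega

theorem card_filter_pow_eq_le_of_eq_X_mul {K : Type*} [Field K] [Fintype K] [DecidableEq K]
    {ℓ s : ℕ} [Fact ℓ.Prime] [CharP K ℓ] {Q e R : ℕ} (hQs : Q = ℓ ^ s)
    (hcard : Fintype.card K = Q ^ 2) (hQ : Q = e * R + 1) (hQ4 : 4 ≤ Q)
    {u : K[X]} (hu : u.coeff 0 ≠ 0) {c : K} (hc : c ≠ 0) :
    e * (univ.filter fun x : K => (X * u).eval x ^ (R * (Q + 1)) = c).card ≤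
      Q ^ 2 + e * (Q * (3 * (X * u).natDegree + 2)) := by
  set f : K[X] := X * u with hf
  set D := f.natDegree with hD
  have he : 0 < e := by rcases Nat.eq_zero_or_pos e with rfl | h <;> omega
  have hR : 0 < R := by rcases Nat.eq_zero_or_pos R with rfl | h <;> omega
  set k := R + 2 * (D + 1) with hk
  have hfrob : ∀ x : K, (x ^ Q) ^ Q = x := by
    intro x
    rw [← pow_mul, ← sq, ← hcard, FiniteField.pow_card]
  have hlin : k + (Q * (R - 1) + (e - 1) * R * D) < k * (e * R) := by
    obtain ⟨R', rfl⟩ : ∃ R', R = R' + 1 := ⟨R - 1, by omega⟩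
    obtain ⟨e', rfl⟩ : ∃ e', e = e' + 1 := ⟨e - 1, by omega⟩
    simp only [Nat.add_sub_cancel]
    obtain ⟨Q', rfl⟩ : ∃ Q', Q = Q' + 4 := ⟨Q - 4, by omega⟩
    have h1 : (e' + 1) * (R' + 1) = Q' + 3 := by omega
    rw [h1, hk]
    have h2 : e' * (R' + 1) * D ≤ (Q' + 3) * D := Nat.mul_le_mul_right _ (by nlinarith)
    have h3 : R' + 1 ≤ Q' + 3 := by nlinarith
    nlinarith
  let ι := Fin k × Fin e × Fin R
  have hcι : Fintype.card ι = k * (e * R) := by simp [ι]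
  obtain ⟨a, ha0, ha⟩ := exists_ne_zero_sum_C_mul_eq_zero (K := K) (ι := ι)
    (B := k + (Q * (R - 1) + (e - 1) * R * D)) (by rw [hcι]; exact hlin)
    (g := fun t => X ^ (Q * t.2.2 + t.1) * (C (c ^ (t.2.1 : ℕ)) * f ^ ((e - 1 - t.2.1) * R)))
    (by
      rintro ⟨i, j, m⟩
      refine lt_of_le_of_lt degree_le_natDegree ?_
      rw [Nat.cast_lt]
      simp only
      refine lt_of_le_of_lt natDegree_mul_le ?_
      refine lt_of_le_of_lt (add_le_add (natDegree_X_pow_le _)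
        ((natDegree_C_mul_le _ _).trans natDegree_pow_le)) ?_
      rw [← hD]
      have h1 := i.2
      have h2 : Q * m ≤ Q * (R - 1) := Nat.mul_le_mul_left _ (by omega)
      have h3 : (e - 1 - j) * R * D ≤ (e - 1) * R * D :=
        Nat.mul_le_mul_right _ (Nat.mul_le_mul_right _ (by omega))
      omega)
  let Ψ : K[X] := ∑ t : ι, C (a t ^ Q) *
    (X ^ ((t.2.2 : ℕ) + (t.2.1 : ℕ) * R + (t.1 : ℕ) * Q) * u ^ ((t.2.1 : ℕ) * R))
  have hΨ0 : Ψ ≠ 0 := by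
    refine sum_C_mul_X_pow_mul_ne_zero (injective_mixed_radix hQ) (fun t => ?_)
      (a := fun t => a t ^ Q) (fun h => ha0 ?_)
    · rw [coeff_zero_eq_eval_zero] at hu ⊢
      rw [eval_pow]
      exact pow_ne_zero _ hu
    · ext t
      exact eq_zero_of_pow_eq_zero (congrFun h t)
  have hΨdeg : Ψ.natDegree ≤ (R - 1) + (e - 1) * R * D + (k - 1) * Q := by
    refine natDegree_sum_le_of_forall_le _ _ ?_
    rintro ⟨i, j, m⟩ -
    simp only
    refine (natDegree_C_mul_le _ _).trans ?_
    have : (X : K[X]) ^ ((m : ℕ) + (j : ℕ) * R + (i : ℕ) * Q) * u ^ ((j : ℕ) * R) =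
        X ^ ((m : ℕ) + (i : ℕ) * Q) * f ^ ((j : ℕ) * R) := by
      rw [hf, mul_pow]; ring
    rw [this]
    refine natDegree_mul_le.trans ((add_le_add (natDegree_X_pow_le _) natDegree_pow_le).trans ?_)
    rw [← hD]
    have h1 : (i : ℕ) * Q ≤ (k - 1) * Q := Nat.mul_le_mul_right _ (by omega)
    have h3 : j * R * D ≤ (e - 1) * R * D :=
        Nat.mul_le_mul_right _ (Nat.mul_le_mul_right _ (by omega))
    omega
  have hroot : ∀ x : K, f.eval x ^ (R * (Q + 1)) = c → Ψ.IsRoot x := by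
    intro x hx
    have hfx : f.eval x ≠ 0 := by
      intro h
      rw [h, zero_pow (by positivity)] at hx
      exact hc hx.symm
    have key : Ψ.eval x ^ Q * f.eval x ^ ((e - 1) * R) = 0 := by
      have h0 := congrArg (eval x) ha
      rw [eval_zero] at h0
      rw [← h0, eval_finsetSum, eval_finsetSum, hQs, sum_pow_char_pow, ← hQs, sum_mul]
      refine sum_congr rfl ?_
      rintro ⟨i, j, m⟩ -
      have hfu : eval x f = x * eval x u := by simp [hf]
      simp only [eval_mul, eval_C, eval_pow, eval_X, mul_pow]
      rw [hfrob]
      have hej : (e - 1) * R = (j : ℕ) * R + (e - 1 - j) * R := by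
        rw [← Nat.add_mul]; congr 1; omega
      rw [← hx, hej]
      have hxQ : (x ^ ((i : ℕ) * Q)) ^ Q = x ^ (i : ℕ) := by
        rw [pow_mul, hfrob]
      calc _ = a (i, j, m) * (x ^ (m : ℕ)) ^ Q * (x ^ ((i : ℕ) * Q)) ^ Q *
            ((x * eval x u) ^ ((j : ℕ) * R)) ^ Q *
            (eval x f ^ ((j : ℕ) * R) * eval x f ^ ((e - 1 - j) * R)) := by
              rw [pow_add, pow_add, mul_pow x]; ring
        _ = _ := by rw [hxQ, ← hfu]; ring
    have := (mul_eq_zero.mp key).resolve_right (pow_ne_zero _ hfx)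
    exact eq_zero_of_pow_eq_zero this
  have hcount : (univ.filter fun x : K => f.eval x ^ (R * (Q + 1)) = c).card ≤ Ψ.natDegree := by
    refine card_le_degree_of_subset_roots (p := Ψ) ?_
    intro x hx
    rw [Finset.mem_val, Finset.mem_filter] at hx
    exact (mem_roots hΨ0).mpr (hroot x hx.2)
  refine (Nat.mul_le_mul_left e (hcount.trans hΨdeg)).trans ?_
  obtain ⟨R', rfl⟩ : ∃ R', R = R' + 1 := ⟨R - 1, by omega⟩
  obtain ⟨e', rfl⟩ : ∃ e', e = e' + 1 := ⟨e - 1, by omega⟩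
  have hk1 : k - 1 = R' + 2 * D + 2 := by omega
  rw [hk1]
  simp only [Nat.add_sub_cancel]
  have h1 : e' * (R' + 1) * D ≤ Q * D := Nat.mul_le_mul_right _ (by nlinarith)
  have h2 : (e' + 1) * (R' + 1) * Q ≤ Q * Q := Nat.mul_le_mul_right _ (by omega)
  have h3 : R' ≤ Q := by nlinarith
  have h4 : R' + e' * (R' + 1) * D + (R' + 2 * D + 2) * Q ≤
      (R' + 1) * Q + Q * (3 * D + 2) := by nlinarith
  calc _ ≤ (e' + 1) * ((R' + 1) * Q + Q * (3 * D + 2)) := Nat.mul_le_mul_left _ h4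
    _ ≤ _ := by nlinarith

/-- Stepanov's method: if `f` has a simple zero in the field `K` of order `Q ^ 2` and
`e ∣ Q - 1`, then `f (x) ^ ((Q ^ 2 - 1) / e)` takes every nonzero value about `Q ^ 2 / e` times
at most. -/
theorem card_filter_eval_pow_eq_le {K : Type*} [Field K] [Fintype K] [DecidableEq K]
    {ℓ s : ℕ} [Fact ℓ.Prime] [CharP K ℓ] {Q e R : ℕ} (hQs : Q = ℓ ^ s)
    (hcard : Fintype.card K = Q ^ 2) (hQ : Q = e * R + 1) (hQ4 : 4 ≤ Q)
    {f : K[X]} {θ : K} (hθ : f.IsRoot θ) (hθ' : f.derivative.eval θ ≠ 0) {c : K} (hc : c ≠ 0) :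
    e * (univ.filter fun x : K => f.eval x ^ (R * (Q + 1)) = c).card ≤
      Q ^ 2 + e * (Q * (3 * f.natDegree + 2)) := by
  obtain ⟨g, rfl⟩ := dvd_iff_isRoot.mpr hθ
  have hg : g.eval θ ≠ 0 := by simpa [derivative_mul] using hθ'
  have hcomp : ((X - C θ) * g).comp (X + C θ) = X * g.comp (X + C θ) := by simp
  have hu : (g.comp (X + C θ)).coeff 0 ≠ 0 := by
    simpa [coeff_zero_eq_eval_zero, eval_comp] using hg
  have h := card_filter_pow_eq_le_of_eq_X_mul hQs hcard hQ hQ4 hu hc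
  rw [← hcomp, natDegree_comp, natDegree_X_add_C, mul_one] at h
  refine le_trans (le_of_eq ?_) h
  congr 1
  refine card_bij' (fun x _ => x - θ) (fun x _ => x + θ) ?_ ?_ ?_ ?_ <;>
    simp [eval_comp]

end Stepanov

section CharacterSums

open Polynomial

theorem norm_mulChar_eq_one {F : Type*} [Field F] [Fintype F] (χ : MulChar F ℂ) {a : F}
    (ha : a ≠ 0) : ‖χ a‖ = 1 := by
  classical
  have h := congrArg (fun ψ : MulChar F ℂ => ψ a) χ.pow_card_eq_one
  refine Complex.norm_eq_one_of_pow_eq_one (n := Fintype.card Fˣ) ?_ Fintype.card_ne_zero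
  simpa [MulChar.pow_apply' χ Fintype.card_ne_zero, MulChar.one_apply (IsUnit.mk0 a ha)] using h

/-- Square-root cancellation, up to a constant factor, for multiplicative character sums over
large extensions of a finite field. -/
theorem norm_sum_mulChar_norm_aeval_le {F K : Type*} [Field F] [Fintype F] [Field K] [Fintype K]
    [Algebra F K] {t : ℕ} (ht : 2 ≤ t) (hK : Fintype.card K = (Fintype.card F ^ t) ^ 2)
    {f : F[X]} (hf : f ≠ 0) {θ : K} (hθ : aeval θ f = 0) (hθ' : aeval θ (derivative f) ≠ 0)
    {χ : MulChar F ℂ} (hχ : χ ≠ 1) :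
    ‖∑ x : K, χ (Algebra.norm F (aeval x f))‖ ≤
      (Fintype.card F * (3 * f.natDegree + 2) + f.natDegree) * (Fintype.card F : ℝ) ^ t := by
  classical
  set q := Fintype.card F with hq
  set D := f.natDegree with hD
  obtain ⟨ℓ, hℓ⟩ := CharP.exists F
  obtain ⟨n, hℓp, hqn⟩ := FiniteField.card F ℓ
  have : Fact ℓ.Prime := ⟨hℓp⟩
  have : CharP K ℓ := charP_of_injective_algebraMap (algebraMap F K).injective ℓ
  have hq1 : 1 < q := Fintype.one_lt_card
  obtain ⟨R, hR⟩ : q - 1 ∣ q ^ t - 1 := by simpa using Nat.sub_dvd_pow_sub_pow q 1 t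
  have hQ : q ^ t = (q - 1) * R + 1 := by
    have : 0 < q ^ t := by positivity
    omega
  have hQ4 : 4 ≤ q ^ t :=
    calc 4 = 2 ^ 2 := by norm_num
      _ ≤ q ^ 2 := Nat.pow_le_pow_left hq1 2
      _ ≤ q ^ t := Nat.pow_le_pow_right (by omega) ht
  have hexp : ((q ^ t) ^ 2 - 1) / (q - 1) = R * (q ^ t + 1) := by
    have : (q ^ t) ^ 2 - 1 = (R * (q ^ t + 1)) * (q - 1) := by
      rw [← one_pow 2, Nat.sq_sub_sq, one_pow, hR]; ac_rfl
    rw [this, Nat.mul_div_cancel _ (by omega)]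
  let M : F → Finset K := fun c => univ.filter fun x => Algebra.norm F (aeval x f) = c
  have hM : ∀ c : F, c ≠ 0 →
      (q - 1) * (M c).card ≤ (q ^ t) ^ 2 + (q - 1) * (q ^ t * (3 * D + 2)) := by
    intro c hc
    have h := card_filter_eval_pow_eq_le (K := K) (ℓ := ℓ) (s := n * t) (Q := q ^ t) (e := q - 1)
      (R := R) (by rw [pow_mul, ← hqn]) hK hQ hQ4 (f := f.map (algebraMap F K)) (θ := θ)
      (by rwa [IsRoot, eval_map_algebraMap]) (by rwa [derivative_map, eval_map_algebraMap])
      (c := algebraMap F K c) (by simpa using hc)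
    rw [natDegree_map, ← hD] at h
    refine le_trans (le_of_eq ?_) h
    congr 2
    ext x
    simp only [M, mem_filter, mem_univ, true_and]
    rw [← (algebraMap F K).injective.eq_iff, FiniteField.algebraMap_norm_eq_pow,
      Nat.card_eq_fintype_card, Nat.card_eq_fintype_card, hK, ← hq, hexp, eval_map_algebraMap]
  have hM0 : (M 0).card ≤ D := by
    have : M 0 ⊆ (f.map (algebraMap F K)).roots.toFinset := by
      intro x hx
      simp only [M, mem_filter, mem_univ, true_and, Algebra.norm_eq_zero_iff] at hx
      rw [Multiset.mem_toFinset, mem_roots (map_ne_zero hf), IsRoot, eval_map_algebraMap, hx]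
    refine (card_le_card this).trans ((Multiset.toFinset_card_le _).trans ?_)
    refine (card_roots' _).trans ?_
    rw [natDegree_map]
  have hMsum : ∑ c, (M c).card = (q ^ t) ^ 2 := by
    rw [← hK, ← Finset.card_univ (α := K)]
    exact (card_eq_sum_card_fiberwise (fun x _ => mem_univ _)).symm
  set b : ℝ := ((q : ℝ) ^ t) ^ 2 / (q - 1) + q ^ t * (3 * D + 2) with hb
  have hq1' : (0 : ℝ) < q - 1 := by
    have : (1 : ℝ) < q := by exact_mod_cast hq1
    linarith
  have hMb : ∀ c : F, c ≠ 0 → ((M c).card : ℝ) ≤ b := by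
    intro c hc
    have h := hM c hc
    have h' : ((q : ℝ) - 1) * (M c).card ≤
        (q ^ t) ^ 2 + (q - 1) * (q ^ t * (3 * D + 2)) := by
      have : ((q - 1 : ℕ) : ℝ) = q - 1 := by rw [Nat.cast_sub hq1.le]; simp
      rw [← this]
      exact_mod_cast h
    rw [hb, div_add' _ _ _ hq1'.ne', le_div_iff₀ hq1']
    linarith
  have hsum : ∑ x : K, χ (Algebra.norm F (aeval x f)) =
      ∑ c ∈ univ.erase (0 : F), (((M c).card : ℂ) - b) * χ c := by
    have h1 : ∑ x : K, χ (Algebra.norm F (aeval x f)) = ∑ c, ((M c).card : ℂ) * χ c := by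
      rw [← sum_fiberwise (s := univ) (g := fun x : K => Algebra.norm F (aeval x f))]
      refine sum_congr rfl fun c _ => ?_
      rw [sum_congr rfl (g := fun _ => χ c) (fun x hx => by rw [(mem_filter.mp hx).2])]
      simp [M]
    have h2 : ∑ c, (((M c).card : ℂ) - b) * χ c = ∑ c, ((M c).card : ℂ) * χ c := by
      simp_rw [sub_mul]
      rw [sum_sub_distrib, ← mul_sum, MulChar.sum_eq_zero_of_ne_one hχ, mul_zero, sub_zero]
    rw [h1, ← h2, ← sum_erase univ (a := (0 : F)) (by rw [MulChar.map_zero, mul_zero])]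
  rw [hsum]
  calc _ ≤ ∑ c ∈ univ.erase (0 : F), (b - (M c).card) := by
        refine (norm_sum_le _ _).trans (sum_le_sum fun c hc => ?_)
        have hc0 := ne_of_mem_erase hc
        rw [norm_mul, norm_mulChar_eq_one χ hc0, mul_one, norm_sub_rev]
        rw [show (b : ℂ) - ((M c).card : ℂ) = ((b - (M c).card : ℝ) : ℂ) by push_cast; rfl]
        rw [Complex.norm_real, Real.norm_eq_abs, abs_of_nonneg (sub_nonneg.mpr (hMb c hc0))]
    _ = (q - 1) * b - ((q : ℝ) ^ t) ^ 2 + (M 0).card := by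
        have h1 : ∑ c ∈ univ.erase (0 : F), ((M c).card : ℝ) =
            ((q : ℝ) ^ t) ^ 2 - (M 0).card := by
          rw [sum_erase_eq_sub (mem_univ _), ← Nat.cast_sum, hMsum]
          push_cast; rfl
        rw [sum_sub_distrib, h1, sum_const, card_erase_of_mem (mem_univ _), card_univ, ← hq,
          nsmul_eq_mul, Nat.cast_sub hq1.le]
        push_cast; ring
    _ = (q - 1) * (q ^ t * (3 * D + 2)) + (M 0).card := by
        rw [hb, mul_add, mul_div_cancel₀ _ hq1'.ne']; ring
    _ ≤ q * (q ^ t * (3 * D + 2)) + D * q ^ t := by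
        have h1 : ((M 0).card : ℝ) ≤ D * q ^ t := by
          exact_mod_cast hM0.trans (Nat.le_mul_of_pos_right _ (by positivity))
        have h2 : (0 : ℝ) ≤ q ^ t * (3 * D + 2) := by positivity
        linarith
    _ = _ := by ring

end CharacterSums

section PowerSums

/-- If the power sums of finitely many complex numbers are `O(ρ ^ n)`, then all of the numbers
have absolute value at most `ρ`. -/
theorem norm_le_of_norm_sum_pow_le {ι : Type*} [Fintype ι] (α : ι → ℂ) {A ρ : ℝ} (hρ : 0 ≤ ρ)
    (h : ∀ n : ℕ, 0 < n → ‖∑ i, α i ^ n‖ ≤ A * ρ ^ n) (j : ι) : ‖α j‖ ≤ ρ := by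
  classical
  by_contra! hlt
  let P : Polynomial ℂ := ∏ β ∈ (univ.image α).erase (α j), (Polynomial.X - Polynomial.C β)
  have hP0 : P.eval (α j) ≠ 0 := by
    rw [Polynomial.eval_prod, prod_ne_zero_iff]
    intro β hβ
    simpa [sub_eq_zero] using (ne_of_mem_erase hβ).symm
  have hP : ∀ i, α i ≠ α j → P.eval (α i) = 0 := by
    intro i hi
    rw [Polynomial.eval_prod]
    exact prod_eq_zero (i := α i) (mem_erase.mpr ⟨hi, mem_image_of_mem _ (mem_univ _)⟩) (by simp)
  set μ : ℂ := ((univ.filter fun i => α i = α j).card : ℂ) * P.eval (α j) with hμ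
  have hμ0 : μ ≠ 0 := by
    refine mul_ne_zero ?_ hP0
    rw [Nat.cast_ne_zero, card_ne_zero]
    exact ⟨j, by simp⟩
  set B : ℝ := ∑ k ∈ range (P.natDegree + 1), ‖P.coeff k‖ * (A * ρ ^ k) with hB
  have key : ∀ n : ℕ, 0 < n → ‖μ‖ * ‖α j‖ ^ n ≤ B * ρ ^ n := by
    intro n hn
    have h1 : μ * α j ^ n = ∑ k ∈ range (P.natDegree + 1), P.coeff k * ∑ i, α i ^ (n + k) := by
      calc μ * α j ^ n = ∑ i, P.eval (α i) * α i ^ n := by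
            rw [hμ, ← sum_filter_add_sum_filter_not univ (fun i => α i = α j)]
            rw [sum_congr rfl (g := fun _ => P.eval (α j) * α j ^ n)
              (fun i hi => by rw [(mem_filter.mp hi).2])]
            rw [sum_eq_zero (s := univ.filter fun i => ¬ α i = α j)
              (fun i hi => by rw [hP i (mem_filter.mp hi).2, zero_mul])]
            simp [mul_assoc]
        _ = _ := by
            simp_rw [Polynomial.eval_eq_sum_range, sum_mul, mul_sum]
            rw [sum_comm]
            refine sum_congr rfl fun k _ => sum_congr rfl fun i _ => ?_
            ring
    rw [← norm_pow, ← norm_mul, h1, hB, sum_mul]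
    refine (norm_sum_le _ _).trans (sum_le_sum fun k _ => ?_)
    rw [norm_mul, mul_assoc, mul_assoc, ← pow_add, add_comm k n]
    exact mul_le_mul_of_nonneg_left (h _ (by omega)) (norm_nonneg _)
  have hα : 0 < ‖α j‖ := hρ.trans_lt hlt
  have hlim : Tendsto (fun n : ℕ => B * (ρ / ‖α j‖) ^ n) atTop (nhds (B * 0)) :=
    (tendsto_pow_atTop_nhds_zero_of_lt_one (by positivity) ((div_lt_one hα).mpr hlt)).const_mul B
  rw [mul_zero] at hlim
  have hle : ‖μ‖ ≤ 0 := by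
    refine ge_of_tendsto hlim ?_
    filter_upwards [eventually_gt_atTop 0] with n hn
    rw [div_pow, ← mul_div_assoc, le_div_iff₀ (by positivity)]
    exact key n hn
  exact hμ0 (norm_le_zero_iff.mp hle)

/-- Newton's identities, read backwards: a sequence of Newton type attached to a polynomial
consists of negated power sums. -/
theorem exists_eq_neg_sum_pow {a S : ℕ → ℂ} {m : ℕ} (ha0 : a 0 = 1) (ha : ∀ n, m < n → a n = 0)
    (hS : ∀ n : ℕ, (n : ℂ) * a n = ∑ k ∈ Icc 1 n, S k * a (n - k)) :
    ∃ α : Fin m → ℂ, ∀ k, 0 < k → S k = -∑ i, α i ^ k := by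
  let P : Polynomial ℂ := ∑ k ∈ range (m + 1), Polynomial.monomial (m - k) (a k)
  have hcoeff : ∀ k ≤ m, P.coeff (m - k) = a k := by
    intro k hk
    simp only [P, Polynomial.finsetSum_coeff, Polynomial.coeff_monomial]
    rw [sum_eq_single k]
    · simp
    · intro b hb hbk
      rw [mem_range] at hb
      rw [if_neg (by omega)]
    · intro h
      exact absurd (mem_range.mpr (by omega)) h
  have hdeg : P.natDegree ≤ m :=
    Polynomial.natDegree_sum_le_of_forall_le _ _
      fun k _ => (Polynomial.natDegree_monomial_le _).trans (by omega)
  have hmonic : P.Monic := by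
    refine Polynomial.monic_of_natDegree_le_of_coeff_eq_one m hdeg ?_
    have := hcoeff 0 (Nat.zero_le _)
    rwa [Nat.sub_zero, ha0] at this
  have hdeg' : P.natDegree = m := by
    refine le_antisymm hdeg (Polynomial.le_natDegree_of_ne_zero ?_)
    have := hcoeff 0 (Nat.zero_le _)
    rw [Nat.sub_zero, ha0] at this
    simp [this]
  have hcard : P.roots.card = m := by
    rw [← hdeg']; exact (IsAlgClosed.splits P).natDegree_eq_card_roots.symm
  obtain ⟨α, hα⟩ : ∃ α : Fin m → ℂ, univ.val.map α = P.roots := by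
    have : ∀ (k : ℕ) (s : Multiset ℂ), s.card = k → ∃ α : Fin k → ℂ, univ.val.map α = s := by
      rintro k ⟨l⟩ rfl
      exact ⟨l.get, (Fin.univ_val_map _).trans (congrArg _ (List.ofFn_get l))⟩
    exact this _ _ hcard
  refine ⟨α, ?_⟩
  have hesymm : ∀ k, MvPolynomial.aeval α (MvPolynomial.esymm (Fin m) ℂ k) = (-1) ^ k * a k := by
    intro k
    rw [MvPolynomial.aeval_esymm_eq_multiset_esymm, hα]
    rcases le_or_gt k m with hk | hk
    · have h1 := Polynomial.coeff_eq_esymm_roots_of_card (p := P) (k := m - k)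
        (by rw [hcard, hdeg']) (by omega)
      rw [hcoeff k hk, hmonic.leadingCoeff, hdeg', Nat.sub_sub_self hk, one_mul] at h1
      rw [h1, ← mul_assoc, ← mul_pow]
      simp
    · rw [ha k hk, mul_zero, Multiset.esymm, Multiset.powersetCard_eq_empty _ (by omega)]
      simp
  have hpsum : ∀ k, MvPolynomial.aeval α (MvPolynomial.psum (Fin m) ℂ k) = ∑ i, α i ^ k := by
    intro k; simp [MvPolynomial.psum]
  have hnewton : ∀ n : ℕ, (n : ℂ) * a n = ∑ k ∈ Icc 1 n, (-∑ i, α i ^ k) * a (n - k) := by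
    intro n
    have h := congrArg (MvPolynomial.aeval α) (MvPolynomial.mul_esymm_eq_sum (Fin m) ℂ n)
    simp only [map_mul, map_natCast, map_pow, map_neg, map_one, map_sum, hesymm, hpsum] at h
    have h' : ∑ b ∈ antidiagonal n with b.1 < n,
        (-1 : ℂ) ^ b.1 * ((-1) ^ b.1 * a b.1) * ∑ i, α i ^ b.2 =
        ∑ k ∈ Icc 1 n, (∑ i, α i ^ k) * a (n - k) := by
      refine sum_bij' (fun b _ => b.2) (fun k _ => (n - k, k)) ?_ ?_ ?_ ?_ ?_
      · rintro ⟨b, c⟩ hb; simp at hb ⊢; omega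
      · intro k hk; simp at hk ⊢; omega
      · rintro ⟨b, c⟩ hb; simp at hb ⊢; omega
      · intro k hk; simp
      · rintro ⟨b, c⟩ hb
        simp only [mem_filter, HasAntidiagonal.mem_antidiagonal] at hb
        have : b = n - c := by omega
        rw [← mul_assoc, ← mul_pow, ← this]
        simp [mul_comm]
    rw [h'] at h
    have hs : ((-1 : ℂ) ^ n) ≠ 0 := by simp
    apply mul_left_cancel₀ hs
    calc (-1 : ℂ) ^ n * (n * a n) = n * ((-1) ^ n * a n) := by ring
      _ = _ := by rw [h]; simp only [neg_mul, sum_neg_distrib]; ring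
  intro k
  induction k using Nat.strong_induction_on with
  | _ k ih =>
    intro hk
    have h := (hS k).symm.trans (hnewton k)
    obtain ⟨k, rfl⟩ : ∃ l, k = l + 1 := ⟨k - 1, by omega⟩
    rw [sum_Icc_succ_top (by omega), sum_Icc_succ_top (by omega)] at h
    have hsum : ∑ l ∈ Icc 1 k, S l * a (k + 1 - l) =
        ∑ l ∈ Icc 1 k, (-∑ i, α i ^ l) * a (k + 1 - l) := by
      refine sum_congr rfl fun l hl => ?_
      rw [mem_Icc] at hl
      rw [ih l (by omega) (by omega)]
    rw [hsum] at h
    simpa [ha0] using h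

end PowerSums

section Resultant

open Polynomial IntermediateField

/-- The resultant of a monic `P` with `g` is the product of the values of `g` at the roots of
`P`. -/
theorem algebraMap_resultant_of_monic {F E : Type*} [Field F] [Field E] [Algebra F E]
    [IsAlgClosed E] {P : F[X]} (hP : P.Monic) (g : F[X]) :
    algebraMap F E (resultant P g) = ((P.aroots E).map fun θ => aeval θ g).prod := by
  have h := resultant_eq_prod_eval (P.map (algebraMap F E)) (g.map (algebraMap F E)) g.natDegree
    natDegree_map_le (IsAlgClosed.splits _)
  rw [natDegree_map, resultant_map_map, (hP.map _).leadingCoeff, one_pow, one_mul] at h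
  rw [h, aroots_def]
  simp_rw [eval_map_algebraMap]

/-- The norm of a polynomial expression in `x` is a power of the resultant with `minpoly F x`. -/
theorem norm_aeval_eq_resultant_pow {F K : Type*} [Field F] [Field K] [Algebra F K]
    [FiniteDimensional F K] [Algebra.IsSeparable F K] (f : F[X]) (x : K) :
    Algebra.norm F (aeval x f) =
      resultant (minpoly F x) f ^ (Module.finrank F K / (minpoly F x).natDegree) := by
  classical
  have hx : IsIntegral F x := Algebra.IsIntegral.isIntegral x
  have h1 : aeval x f = algebraMap F⟮x⟯ K (aeval (AdjoinSimple.gen F x) f) := by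
    rw [← aeval_algebraMap_apply, AdjoinSimple.algebraMap_gen]
  have hdeg : Module.finrank F⟮x⟯ K = Module.finrank F K / (minpoly F x).natDegree := by
    rw [← adjoin.finrank hx, ← Module.finrank_mul_finrank F F⟮x⟯ K,
      Nat.mul_div_cancel_left _ Module.finrank_pos]
  rw [h1, ← Algebra.norm_norm (R := F) (S := F⟮x⟯), Algebra.norm_algebraMap, map_pow, hdeg]
  congr 1
  apply (algebraMap F (AlgebraicClosure F)).injective
  rw [algebraMap_resultant_of_monic (minpoly.monic hx), Algebra.norm_eq_prod_embeddings]
  set M := (minpoly F x).aroots (AlgebraicClosure F) with hM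
  have hnd : M.Nodup :=
    nodup_roots (Polynomial.Separable.map (Algebra.IsSeparable.isSeparable F x))
  calc _ = ∏ θ : {θ // θ ∈ M}, aeval θ.1 f := by
        refine Fintype.prod_equiv (algHomAdjoinIntegralEquiv F hx) _ _ fun σ => ?_
        obtain ⟨θ, rfl⟩ := (algHomAdjoinIntegralEquiv F hx).symm.surjective σ
        rw [Equiv.apply_symm_apply, ← aeval_algHom_apply,
          algHomAdjoinIntegralEquiv_symm_apply_gen]
    _ = ∏ θ ∈ M.toFinset, aeval θ f :=
        (prod_subtype _ (fun θ => Multiset.mem_toFinset) fun θ => aeval θ f).symm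
    _ = _ := by
        rw [Finset.prod_eq_multiset_prod, Multiset.toFinset_val, hnd.dedup]

/-- The finite set of monic polynomials of degree `n` over a finite field. -/
noncomputable def monicsOfDegree (F : Type*) [Field F] [Finite F] (n : ℕ) : Finset F[X] :=
  Set.Finite.toFinset (s := {g : F[X] | g.Monic ∧ g.natDegree = n}) <| by
    have : Finite (degreeLT F (n + 1)) := Finite.of_equiv _ (degreeLTEquiv F (n + 1)).toEquiv.symm
    refine Set.Finite.subset (Set.toFinite (degreeLT F (n + 1) : Set F[X])) fun g hg => ?_
    rw [SetLike.mem_coe, mem_degreeLT, ← hg.2]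
    exact lt_of_le_of_lt degree_le_natDegree (by exact_mod_cast Nat.lt_succ_self _)

@[simp]
theorem mem_monicsOfDegree {F : Type*} [Field F] [Finite F] {n : ℕ} {g : F[X]} :
    g ∈ monicsOfDegree F n ↔ g.Monic ∧ g.natDegree = n := by
  simp [monicsOfDegree]

theorem resultant_eq_of_dvd_sub {F : Type*} [Field F] {f : F[X]} (hf : f.Monic) {g h : F[X]}
    (hgh : f ∣ g - h) : resultant f g = resultant f h := by
  apply (algebraMap F (AlgebraicClosure F)).injective
  rw [algebraMap_resultant_of_monic hf, algebraMap_resultant_of_monic hf]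
  congr 1
  refine Multiset.map_congr rfl fun θ hθ => ?_
  obtain ⟨k, hk⟩ := hgh
  rw [← sub_eq_zero, ← map_sub, hk, map_mul, (mem_aroots.mp hθ).2, zero_mul]

theorem resultant_mul_right_of_monic {F : Type*} [Field F] {f : F[X]} (hf : f.Monic) (g h : F[X]) :
    resultant f (g * h) = resultant f g * resultant f h := by
  apply (algebraMap F (AlgebraicClosure F)).injective
  simp_rw [map_mul, algebraMap_resultant_of_monic hf, map_mul]
  exact Multiset.prod_map_mul

/-- A nontrivial character takes a value other than `0` and `1` at some resultant with a given
squarefree polynomial. -/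
theorem exists_mulChar_resultant_ne_one {F : Type*} [Field F] [Finite F] {f : F[X]} (hf : f.Monic)
    (hsf : Squarefree f) (hdeg : f.natDegree ≠ 0) {χ : MulChar F ℂ} (hχ : χ ≠ 1) :
    ∃ u : F[X], IsCoprime f u ∧ χ (resultant f u) ≠ 1 := by
  obtain ⟨z, hz⟩ := MulChar.ne_one_iff.mp hχ
  obtain ⟨f₁, hf₁m, hf₁, f₂, rfl⟩ := exists_monic_irreducible_factor f
    (not_isUnit_of_natDegree_pos f (Nat.pos_of_ne_zero hdeg))
  have hf₂ : f₂.Monic := hf₁m.of_mul_monic_left hf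
  have : Fact (Irreducible f₁) := ⟨hf₁⟩
  have : FiniteDimensional F (AdjoinRoot f₁) := (AdjoinRoot.powerBasis hf₁.ne_zero).finite
  have : Finite (AdjoinRoot f₁) := Module.finite_of_finite F
  obtain ⟨y, hy⟩ := FiniteField.norm_surjective F (AdjoinRoot f₁) z
  obtain ⟨g, rfl⟩ := AdjoinRoot.mk_surjective y
  have hres : resultant f₁ g = z := by
    rw [← hy, ← AdjoinRoot.aeval_eq, norm_aeval_eq_resultant_pow,
      AdjoinRoot.minpoly_root hf₁.ne_zero,
      hf₁m.leadingCoeff, inv_one, C_1, mul_one, (AdjoinRoot.powerBasis hf₁.ne_zero).finrank,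
      AdjoinRoot.powerBasis_dim, Nat.div_self hf₁.natDegree_pos, pow_one]
  have hcop : IsCoprime f₁ f₂ := by
    refine (hf₁.coprime_iff_not_dvd).mpr fun ⟨k, hk⟩ => hf₁.not_isUnit (hsf f₁ ⟨k, ?_⟩)
    rw [hk, mul_assoc]
  obtain ⟨a, b, hab⟩ := hcop
  set u := g * (b * f₂) + a * f₁ with hu
  have h₁ : resultant f₁ u = z := by
    rw [← hres]
    refine resultant_eq_of_dvd_sub hf₁m ⟨a - g * a, ?_⟩
    linear_combination g * hab
  have h₂ : resultant f₂ u = 1 := by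
    rw [resultant_eq_of_dvd_sub hf₂ (h := 1) ⟨b * g - b, by linear_combination hab⟩]
    simp
  have h : resultant (f₁ * f₂) u = z := by
    rw [hf₁m.natDegree_mul hf₂, resultant_mul_left _ _ _ _ le_rfl, h₁, h₂, mul_one]
  refine ⟨u, ?_, by rwa [h]⟩
  rw [← isUnit_resultant_iff_isCoprime hf, h]
  exact z.isUnit

/-- Character sums of resultants over monic polynomials of large degree vanish. -/
theorem sum_mulChar_resultant_eq_zero {F : Type*} [Field F] [Finite F] {f : F[X]} (hf : f.Monic)
    (hsf : Squarefree f) (hdeg : f.natDegree ≠ 0) {χ : MulChar F ℂ} (hχ : χ ≠ 1) {n : ℕ}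
    (hn : f.natDegree ≤ n) : ∑ g ∈ monicsOfDegree F n, χ (resultant f g) = 0 := by
  classical
  obtain ⟨u, hu, hχu⟩ := exists_mulChar_resultant_ne_one hf hsf hdeg hχ
  let φ : F[X] → F[X] := fun g => (u * g) %ₘ f + f * (g /ₘ f)
  have hlt (g : F[X]) : (g %ₘ f).degree < f.degree := degree_modByMonic_lt g hf
  have hmaps : ∀ g ∈ monicsOfDegree F n, φ g ∈ monicsOfDegree F n := by
    intro g hg
    rw [mem_monicsOfDegree] at hg
    have hfg : f.degree ≤ g.degree := by
      rw [degree_eq_natDegree hf.ne_zero, degree_eq_natDegree hg.1.ne_zero, hg.2]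
      exact_mod_cast hn
    have hlead : (f * (g /ₘ f)).Monic ∧ (f * (g /ₘ f)).natDegree = n := by
      have hq : (g /ₘ f).Monic := by
        rw [Monic, leadingCoeff_divByMonic_of_monic hf hfg, hg.1]
      refine ⟨hf.mul hq, ?_⟩
      rw [hf.natDegree_mul hq, natDegree_divByMonic _ hf, hg.2]
      omega
    have hd : ((u * g) %ₘ f).degree < (f * (g /ₘ f)).degree := by
      refine (hlt _).trans_le ?_
      rw [degree_eq_natDegree hf.ne_zero, degree_eq_natDegree hlead.1.ne_zero, hlead.2]
      exact_mod_cast hn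
    rw [mem_monicsOfDegree]
    exact ⟨hlead.1.add_of_right hd, by rw [natDegree_add_eq_right_of_degree_lt hd, hlead.2]⟩
  have hdvd : ∀ g, f ∣ φ g - u * g := by
    intro g
    refine ⟨g /ₘ f - (u * g) /ₘ f, ?_⟩
    simp only [φ]
    linear_combination modByMonic_add_div (u * g) f
  have hinj : Function.Injective φ := by
    intro g h hgh
    have hdiv : g /ₘ f = h /ₘ f := by
      rw [← (div_modByMonic_unique (g /ₘ f) _ hf ⟨rfl, hlt (u * g)⟩).1,
        ← (div_modByMonic_unique (h /ₘ f) _ hf ⟨rfl, hlt (u * h)⟩).1]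
      exact congrArg (· /ₘ f) hgh
    have h1 : f ∣ u * (g - h) := by
      have := dvd_sub (hdvd h) (hdvd g)
      rw [hgh] at this
      convert this using 1
      ring
    rw [← modByMonic_add_div g f, ← modByMonic_add_div h f, hdiv,
      modByMonic_eq_of_dvd_sub hf (hu.dvd_of_dvd_mul_left h1)]
  have hbij : ∑ g ∈ monicsOfDegree F n, χ (resultant f g) =
      ∑ g ∈ monicsOfDegree F n, χ (resultant f (φ g)) := by
    have himg : (monicsOfDegree F n).image φ = monicsOfDegree F n := by
      refine eq_of_subset_of_card_le (image_subset_iff.mpr hmaps) ?_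
      rw [card_image_of_injective _ hinj]
    conv_lhs => rw [← himg]
    exact sum_image hinj.injOn
  have hmul : ∑ g ∈ monicsOfDegree F n, χ (resultant f (φ g)) =
      χ (resultant f u) * ∑ g ∈ monicsOfDegree F n, χ (resultant f g) := by
    rw [mul_sum]
    refine sum_congr rfl fun g _ => ?_
    rw [resultant_eq_of_dvd_sub hf (hdvd g), resultant_mul_right_of_monic hf, map_mul]
  rw [hmul] at hbij
  exact eq_zero_of_mul_eq_self_left hχu hbij.symm

end Resultant

section EulerProduct

open Polynomial UniqueFactorizationMonoid

variable {F : Type*} [Field F] [Finite F]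

/-- The finite set of monic irreducible polynomials of degree at most `n` over a finite field. -/
noncomputable def monicIrreducibles (F : Type*) [Field F] [Finite F] (n : ℕ) : Finset F[X] := by
  classical
  exact ((range (n + 1)).biUnion (monicsOfDegree F)).filter Irreducible

@[simp]
theorem mem_monicIrreducibles {n : ℕ} {P : F[X]} :
    P ∈ monicIrreducibles F n ↔ P.Monic ∧ Irreducible P ∧ P.natDegree ≤ n := by
  simp [monicIrreducibles]
  tauto

/-- The `k`-th power sum attached to a weight on monic irreducible polynomials. -/
noncomputable def weightedPrimeSum (c : F[X] → ℂ) (k : ℕ) : ℂ :=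
  ∑ P ∈ monicIrreducibles F k with P.natDegree ∣ k, P.natDegree * c P ^ (k / P.natDegree)

theorem weightedPrimeSum_eq (c : F[X] → ℂ) {k n : ℕ} (hk : 0 < k) (hkn : k ≤ n) :
    weightedPrimeSum c k =
      ∑ P ∈ monicIrreducibles F n with P.natDegree ∣ k, P.natDegree * c P ^ (k / P.natDegree) := by
  refine sum_congr ?_ fun _ _ => rfl
  ext P
  simp only [mem_filter, mem_monicIrreducibles]
  constructor
  · rintro ⟨⟨h1, h2, h3⟩, h4⟩
    exact ⟨⟨h1, h2, h3.trans hkn⟩, h4⟩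
  · rintro ⟨⟨h1, h2, h3⟩, h4⟩
    exact ⟨⟨h1, h2, Nat.le_of_dvd hk h4⟩, h4⟩

open scoped Classical in
/-- Monic multiples of degree `n` of a monic polynomial. -/
theorem sum_monicsOfDegree_filter_dvd {c : F[X] → ℂ}
    (hc : ∀ g h : F[X], g.Monic → h.Monic → c (g * h) = c g * c h) {Q : F[X]} (hQ : Q.Monic)
    {n : ℕ} (hn : Q.natDegree ≤ n) :
    ∑ g ∈ monicsOfDegree F n with Q ∣ g, c g =
      c Q * ∑ h ∈ monicsOfDegree F (n - Q.natDegree), c h := by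
  rw [mul_sum]
  symm
  refine sum_nbij (fun h => Q * h) ?_ ?_ ?_ ?_
  · intro h hh
    rw [mem_monicsOfDegree] at hh
    rw [mem_filter, mem_monicsOfDegree, hQ.natDegree_mul hh.1, hh.2]
    exact ⟨⟨hQ.mul hh.1, by omega⟩, dvd_mul_right _ _⟩
  · exact fun g _ h _ hgh => mul_left_cancel₀ hQ.ne_zero hgh
  · rintro g hg
    rw [mem_coe, mem_filter, mem_monicsOfDegree] at hg
    obtain ⟨⟨hg, hgn⟩, h, rfl⟩ := hg
    have hh : h.Monic := hQ.of_mul_monic_left hg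
    refine ⟨h, ?_, rfl⟩
    rw [mem_coe, mem_monicsOfDegree]
    rw [hQ.natDegree_mul hh] at hgn
    exact ⟨hh, by omega⟩
  · intro h hh
    rw [hc _ _ hQ (mem_monicsOfDegree.mp hh).1]

open scoped Classical in
/-- The degree of a monic polynomial counts its prime power divisors, weighted by degree. -/
theorem sum_natDegree_mul_card_pow_dvd {g : F[X]} (hg : g.Monic) :
    ∑ P ∈ monicIrreducibles F g.natDegree,
      P.natDegree * #{k ∈ Icc 1 g.natDegree | P.natDegree ∣ k ∧ P ^ (k / P.natDegree) ∣ g} =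
      g.natDegree := by
  have hcount : ∀ P ∈ monicIrreducibles F g.natDegree,
      #{k ∈ Icc 1 g.natDegree | P.natDegree ∣ k ∧ P ^ (k / P.natDegree) ∣ g} =
        (normalizedFactors g).count P := by
    intro P hP
    rw [mem_monicIrreducibles] at hP
    obtain ⟨hPm, hP, -⟩ := hP
    have hpos := hP.natDegree_pos
    have hpow (i : ℕ) : P ^ i ∣ g ↔ i ≤ (normalizedFactors g).count P := by
      rw [pow_dvd_iff_le_emultiplicity, emultiplicity_eq_count_normalizedFactors hP hg.ne_zero,
        hPm.normalize_eq_self, Nat.cast_le]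
    rw [← Nat.add_sub_cancel (n := (normalizedFactors g).count P) (m := 1), ← Nat.card_Icc]
    symm
    refine card_nbij (fun i => i * P.natDegree) ?_ ?_ ?_
    · intro i hi
      rw [mem_coe, mem_Icc] at hi
      have hdvd := (hpow i).mpr hi.2
      rw [mem_coe, mem_filter, mem_Icc, Nat.mul_div_cancel _ hpos]
      refine ⟨⟨Nat.mul_pos hi.1 hpos, ?_⟩, dvd_mul_left _ _, hdvd⟩
      exact (natDegree_pow P i).symm.trans_le (natDegree_le_of_dvd hdvd hg.ne_zero)
    · exact fun i _ j _ hij => Nat.eq_of_mul_eq_mul_right hpos hij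
    · intro k hk
      rw [mem_coe, mem_filter, mem_Icc] at hk
      obtain ⟨⟨hk, -⟩, ⟨i, rfl⟩, hi⟩ := hk
      rw [Nat.mul_div_cancel_left _ hpos, hpow] at hi
      exact ⟨i, mem_coe.mpr (mem_Icc.mpr ⟨Nat.pos_of_mul_pos_left hk, hi⟩), mul_comm _ _⟩
  rw [sum_congr rfl fun P hP => by rw [hcount P hP]]
  have hmonic : ∀ P ∈ normalizedFactors g, P.Monic := fun P hP => by
    rw [← normalize_normalized_factor P hP]
    exact monic_normalize (irreducible_of_normalized_factor P hP).ne_zero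
  have hprod : (normalizedFactors g).prod = g := by
    rw [prod_normalizedFactors_eq hg.ne_zero, hg.normalize_eq_self]
  conv_rhs => rw [← hprod, natDegree_multiset_prod_of_monic _ hmonic, sum_multiset_map_count]
  symm
  refine sum_subset_zero_on_sdiff ?_ ?_ fun P _ => by rw [smul_eq_mul, mul_comm]
  · intro P hP
    rw [Multiset.mem_toFinset] at hP
    rw [mem_monicIrreducibles]
    exact ⟨hmonic P hP, irreducible_of_normalized_factor P hP,
      natDegree_le_of_dvd (dvd_of_mem_normalizedFactors hP) hg.ne_zero⟩
  · intro P hP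
    rw [Finset.mem_sdiff, Multiset.mem_toFinset] at hP
    rw [Multiset.count_eq_zero_of_notMem hP.2, mul_zero]

/-- The logarithmic derivative of the Euler product of a completely multiplicative weight. -/
theorem mul_sum_monicsOfDegree_eq {c : F[X] → ℂ} (hc1 : c 1 = 1)
    (hc : ∀ g h : F[X], g.Monic → h.Monic → c (g * h) = c g * c h) (n : ℕ) :
    (n : ℂ) * ∑ g ∈ monicsOfDegree F n, c g =
      ∑ k ∈ Icc 1 n, weightedPrimeSum c k * ∑ g ∈ monicsOfDegree F (n - k), c g := by
  classical
  have hpow {P : F[X]} (hP : P.Monic) (i : ℕ) : c (P ^ i) = c P ^ i := by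
    induction i with
    | zero => simp [hc1]
    | succ i ih => rw [pow_succ, hc _ _ (hP.pow i) hP, ih, pow_succ]
  have hterm : ∀ k ∈ Icc 1 n, weightedPrimeSum c k * ∑ g ∈ monicsOfDegree F (n - k), c g =
      ∑ g ∈ monicsOfDegree F n, ∑ P ∈ monicIrreducibles F n,
        if P.natDegree ∣ k ∧ P ^ (k / P.natDegree) ∣ g then P.natDegree * c g else 0 := by
    intro k hk
    rw [mem_Icc] at hk
    rw [weightedPrimeSum_eq c hk.1 hk.2, sum_mul, sum_comm, sum_filter]
    refine sum_congr rfl fun P hP => ?_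
    rw [mem_monicIrreducibles] at hP
    split_ifs with hdvd
    · have hdeg : (P ^ (k / P.natDegree)).natDegree = k := by
        rw [natDegree_pow, Nat.div_mul_cancel hdvd]
      have h := sum_monicsOfDegree_filter_dvd hc (hP.1.pow (k / P.natDegree)) (hdeg.trans_le hk.2)
      rw [hdeg, hpow hP.1] at h
      rw [mul_assoc, ← h, mul_sum, sum_filter]
      simp [hdvd]
    · simp [hdvd]
  rw [sum_congr (M := ℂ) rfl hterm, sum_comm, mul_sum]
  refine sum_congr rfl fun g hg => ?_
  rw [mem_monicsOfDegree] at hg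
  obtain ⟨hg, rfl⟩ := hg
  rw [sum_comm]
  conv_lhs => rw [← sum_natDegree_mul_card_pow_dvd hg]
  rw [Nat.cast_sum, sum_mul]
  refine sum_congr rfl fun P _ => ?_
  rw [← sum_filter, sum_const, nsmul_eq_mul]
  push_cast
  ring

end EulerProduct

section WeilBound

open Polynomial

theorem card_filter_minpoly_eq {F K : Type*} [Field F] [Finite F] [Field K] [Fintype K]
    [Algebra F K] [DecidableEq F[X]] {P : F[X]} (hPm : P.Monic) (hP : Irreducible P)
    (hdvd : P.natDegree ∣ Module.finrank F K) :
    #{x : K | minpoly F x = P} = P.natDegree := by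
  classical
  have : Fact (Irreducible P) := ⟨hP⟩
  have hfin : Module.finrank F (AdjoinRoot P) = P.natDegree := by
    rw [(AdjoinRoot.powerBasis hP.ne_zero).finrank, AdjoinRoot.powerBasis_dim]
  obtain ⟨φ⟩ := FiniteField.nonempty_algHom_of_finrank_dvd (hfin ▸ hdvd)
  have hroot : aeval (φ (AdjoinRoot.root P)) P = 0 := by
    rw [aeval_algHom_apply, AdjoinRoot.aeval_eq, AdjoinRoot.mk_self, map_zero]
  have hsplits : (P.map (algebraMap F K)).Splits := by
    rw [minpoly.eq_of_irreducible_of_monic hP hroot hPm]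
    exact Normal.splits inferInstance _
  rw [← card_rootSet_eq_natDegree (PerfectField.separable_of_irreducible hP) hsplits,
    ← Set.toFinset_card]
  congr 1
  ext x
  rw [mem_filter, Set.mem_toFinset, mem_rootSet]
  refine ⟨?_, fun h => ⟨mem_univ _, (minpoly.eq_of_irreducible_of_monic hP h.2 hPm).symm⟩⟩
  rintro ⟨-, rfl⟩
  exact ⟨hP.ne_zero, minpoly.aeval F x⟩

/-- Character sums of norms over an extension are power sums over monic irreducibles. -/
theorem sum_mulChar_norm_aeval_eq {F K : Type*} [Field F] [Finite F] [Field K] [Fintype K]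
    [Algebra F K] (f : F[X]) (χ : MulChar F ℂ) :
    ∑ x : K, χ (Algebra.norm F (aeval x f)) =
      weightedPrimeSum (fun P => χ (resultant P f)) (Module.finrank F K) := by
  classical
  have hint (x : K) : IsIntegral F x := Algebra.IsIntegral.isIntegral x
  rw [weightedPrimeSum, ← sum_fiberwise_of_maps_to (s := univ) (g := fun x : K => minpoly F x)]
  · refine sum_congr rfl fun P hP => ?_
    rw [mem_filter, mem_monicIrreducibles] at hP
    obtain ⟨⟨hPm, hP, -⟩, hdvd⟩ := hP
    rw [← card_filter_minpoly_eq hPm hP hdvd, ← nsmul_eq_mul, ← sum_const,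
      card_filter_minpoly_eq hPm hP hdvd]
    refine sum_congr rfl fun x hx => ?_
    obtain rfl := (mem_filter.mp hx).2
    rw [norm_aeval_eq_resultant_pow, map_pow]
  · intro x _
    rw [mem_filter, mem_monicIrreducibles]
    exact ⟨⟨minpoly.monic (hint x), minpoly.irreducible (hint x), minpoly.natDegree_le x⟩,
      minpoly.degree_dvd (hint x)⟩

theorem exists_aeval_eq_zero_of_dvd_finrank {F K : Type*} [Field F] [Field K] [Finite K]
    [Algebra F K] {P f : F[X]} (hP : Irreducible P) (hPf : P ∣ f)
    (hdvd : P.natDegree ∣ Module.finrank F K) : ∃ θ : K, aeval θ f = 0 := by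
  have : Fact (Irreducible P) := ⟨hP⟩
  have hfin : Module.finrank F (AdjoinRoot P) = P.natDegree := by
    rw [(AdjoinRoot.powerBasis hP.ne_zero).finrank, AdjoinRoot.powerBasis_dim]
  obtain ⟨φ⟩ := FiniteField.nonempty_algHom_of_finrank_dvd (hfin ▸ hdvd)
  obtain ⟨g, rfl⟩ := hPf
  refine ⟨φ (AdjoinRoot.root P), ?_⟩
  rw [aeval_algHom_apply, AdjoinRoot.aeval_eq, map_mul, AdjoinRoot.mk_self, zero_mul, map_zero]

/-- The character sum over the points of degree `4 * r * n` is small, where `r` is the degree of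
an irreducible factor. -/
theorem norm_weightedPrimeSum_le {F : Type*} [Field F] [Fintype F] {f P : F[X]}
    (hsf : Squarefree f) (hP : Irreducible P) (hPf : P ∣ f) {χ : MulChar F ℂ} (hχ : χ ≠ 1) {n : ℕ}
    (hn : 0 < n) :
    ‖weightedPrimeSum (fun Q => χ (resultant Q f)) (4 * P.natDegree * n)‖ ≤
      (Fintype.card F * (3 * f.natDegree + 2) + f.natDegree) *
        ((Fintype.card F : ℝ) ^ (2 * P.natDegree)) ^ n := by
  obtain ⟨ℓ, hℓ⟩ := CharP.exists F
  have : Fact ℓ.Prime := ⟨CharP.char_is_prime F ℓ⟩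
  have hpos := hP.natDegree_pos
  have : NeZero (4 * P.natDegree * n) := ⟨by positivity⟩
  let K := FiniteField.Extension F ℓ (4 * P.natDegree * n)
  let : Fintype K := Fintype.ofFinite K
  have hfin : Module.finrank F K = 4 * P.natDegree * n := FiniteField.finrank_extension F ℓ _
  have hcard : Fintype.card K = (Fintype.card F ^ (2 * P.natDegree * n)) ^ 2 := by
    rw [← pow_mul, Fintype.card_eq_nat_card, Fintype.card_eq_nat_card,
      FiniteField.natCard_extension]
    congr 1
    ring
  obtain ⟨θ, hθ⟩ := exists_aeval_eq_zero_of_dvd_finrank (K := K) hP hPf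
    (by rw [hfin]; exact ⟨4 * n, by ring⟩)
  have hθ' : aeval θ (derivative f) ≠ 0 :=
    (PerfectField.separable_iff_squarefree.mpr hsf).aeval_derivative_ne_zero hθ
  have h := norm_sum_mulChar_norm_aeval_le (t := 2 * P.natDegree * n)
    (by nlinarith [Nat.mul_pos hpos hn]) hcard hsf.ne_zero hθ hθ' hχ
  rwa [sum_mulChar_norm_aeval_eq, hfin, pow_mul] at h

theorem norm_sum_mulChar_eval_le_of_monic {F : Type*} [Field F] [Fintype F] {f : F[X]}
    (hf : f.Monic) (hsf : Squarefree f) (hdeg : 0 < f.natDegree) {χ : MulChar F ℂ} (hχ : χ ≠ 1) :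
    ‖∑ x : F, χ (f.eval x)‖ ≤ ((f.natDegree : ℝ) - 1) * √(Fintype.card F) := by
  set c : F[X] → ℂ := fun Q => χ (resultant Q f) with hc
  have hc1 : c 1 = 1 := by simp [hc]
  have hcmul (g h : F[X]) (hg : g.Monic) (hh : h.Monic) : c (g * h) = c g * c h := by
    simp only [hc]
    rw [hg.natDegree_mul hh, resultant_mul_left _ _ _ _ le_rfl, map_mul]
  obtain ⟨α, hα⟩ := exists_eq_neg_sum_pow (a := fun n => ∑ g ∈ monicsOfDegree F n, c g)
    (S := weightedPrimeSum c) (m := f.natDegree - 1)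
    (by
      have : monicsOfDegree F 0 = {1} := by
        ext g
        rw [mem_monicsOfDegree, mem_singleton]
        exact ⟨fun h => eq_one_of_monic_natDegree_zero h.1 h.2,
          fun h => h ▸ ⟨monic_one, natDegree_one⟩⟩
      simp only [this, sum_singleton, hc1])
    (by
      intro n hn
      have h : ∀ g ∈ monicsOfDegree F n,
          c g = χ ((-1) ^ (n * f.natDegree)) * χ (resultant f g) := by
        intro g hg
        rw [← map_mul]
        simp only [hc]
        rw [resultant_comm, (mem_monicsOfDegree.mp hg).2]
      rw [sum_congr rfl h, ← mul_sum, sum_mulChar_resultant_eq_zero hf hsf hdeg.ne' hχ (by omega),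
        mul_zero])
    (mul_sum_monicsOfDegree_eq hc1 hcmul)
  obtain ⟨P, -, hP, hPf⟩ := exists_monic_irreducible_factor f (not_isUnit_of_natDegree_pos f hdeg)
  have hpos := hP.natDegree_pos
  have hnorm : ∀ i, ‖α i‖ ≤ √(Fintype.card F) := by
    intro i
    have h := norm_le_of_norm_sum_pow_le (fun i => α i ^ (4 * P.natDegree))
      (ρ := (Fintype.card F : ℝ) ^ (2 * P.natDegree))
      (A := Fintype.card F * (3 * f.natDegree + 2) + f.natDegree) (by positivity)
      (fun n hn => by
        simp_rw [← pow_mul]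
        rw [← norm_neg, ← hα _ (by positivity), pow_mul]
        exact norm_weightedPrimeSum_le hsf hP hPf hχ hn) i
    rw [norm_pow] at h
    refine le_of_pow_le_pow_left₀ (n := 4 * P.natDegree) (by omega) (Real.sqrt_nonneg _)
      (h.trans_eq ?_)
    rw [show 4 * P.natDegree = 2 * (2 * P.natDegree) by ring, pow_mul √_,
      Real.sq_sqrt (Nat.cast_nonneg _)]
  have hsum : ∑ x : F, χ (f.eval x) = -∑ i, α i := by
    have h := sum_mulChar_norm_aeval_eq (K := F) f χ
    rw [Module.finrank_self, hα 1 one_pos] at h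
    simpa [Algebra.norm_self] using h
  rw [hsum, norm_neg]
  refine (norm_sum_le_of_le _ fun i _ => hnorm i).trans_eq ?_
  rw [sum_const, card_univ, Fintype.card_fin, nsmul_eq_mul, Nat.cast_sub hdeg, Nat.cast_one]

/-- Weil's bound for multiplicative character sums with squarefree polynomial argument. -/
theorem norm_sum_mulChar_eval_le {F : Type*} [Field F] [Fintype F] {f : F[X]}
    (hsf : Squarefree f) (hdeg : 0 < f.natDegree) {χ : MulChar F ℂ} (hχ : χ ≠ 1) :
    ‖∑ x : F, χ (f.eval x)‖ ≤ ((f.natDegree : ℝ) - 1) * √(Fintype.card F) := by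
  have hl : f.leadingCoeff ≠ 0 := leadingCoeff_ne_zero.mpr hsf.ne_zero
  have hu : IsUnit (C f.leadingCoeff⁻¹) := isUnit_C.mpr (inv_ne_zero hl).isUnit
  have h := norm_sum_mulChar_eval_le_of_monic (f := f * C f.leadingCoeff⁻¹)
    (monic_mul_leadingCoeff_inv hsf.ne_zero)
    ((associated_mul_unit_left _ _ hu).squarefree_iff.mpr hsf)
    (by rwa [natDegree_mul_leadingCoeff_inv _ hsf.ne_zero]) hχ
  rw [natDegree_mul_leadingCoeff_inv _ hsf.ne_zero] at h
  simp_rw [eval_mul, eval_C, map_mul] at h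
  rwa [← sum_mul, norm_mul, norm_mulChar_eq_one χ (inv_ne_zero hl), mul_one] at h

end WeilBound

section PowerResidues

open Polynomial

theorem mulChar_apply_eq_one_iff {F : Type*} [Field F] [Finite F] (χ : MulChar F ℂ) (a : Fˣ) :
    χ a = 1 ↔ ∃ y : Fˣ, (a : F) = (y : F) ^ orderOf χ := by
  constructor
  · intro h
    obtain ⟨g, hg⟩ := IsCyclic.exists_monoid_generator (α := Fˣ)
    obtain ⟨i, rfl⟩ := Submonoid.mem_powers_iff _ _ |>.mp (hg a)
    have hi : χ ^ i = 1 := by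
      ext b
      obtain ⟨k, rfl⟩ := Submonoid.mem_powers_iff _ _ |>.mp (hg b)
      rw [MulChar.pow_apply_coe, MulChar.one_apply_coe, Units.val_pow_eq_pow_val, map_pow,
        pow_right_comm]
      rw [Units.val_pow_eq_pow_val, map_pow] at h
      rw [h, one_pow]
    obtain ⟨k, rfl⟩ := orderOf_dvd_of_pow_eq_one hi
    exact ⟨g ^ k, by push_cast; rw [← pow_mul, mul_comm]⟩
  · rintro ⟨y, hy⟩
    rw [hy, map_pow, ← MulChar.pow_apply_coe, pow_orderOf_eq_one, MulChar.one_apply_coe]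

open scoped Classical in
theorem sum_range_mulChar_pow_apply {F : Type*} [Field F] [Finite F] (χ : MulChar F ℂ) (a : F) :
    ∑ j ∈ range (orderOf χ), (χ ^ j) a =
      if ∃ y : Fˣ, a = (y : F) ^ orderOf χ then (orderOf χ : ℂ) else 0 := by
  obtain rfl | ha := eq_or_ne a 0
  · rw [if_neg fun ⟨y, hy⟩ => (pow_ne_zero _ y.ne_zero) hy.symm]
    exact sum_eq_zero fun j _ => MulChar.map_zero _
  lift a to Fˣ using ha.isUnit
  simp_rw [MulChar.pow_apply_coe]
  rw [← mulChar_apply_eq_one_iff]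
  split_ifs with h
  · simp [h]
  · have := mul_geom_sum (χ a) (orderOf χ)
    rw [← MulChar.pow_apply_coe, pow_orderOf_eq_one, MulChar.one_apply_coe, sub_self] at this
    exact (mul_eq_zero.mp this).resolve_left (sub_ne_zero.mpr h)

open scoped Classical in
/-- The number of arguments at which a squarefree polynomial takes a `d`-th power residue value. -/
theorem abs_card_filter_eval_eq_pow_sub_le {F : Type*} [Field F] [Fintype F] {d : ℕ}
    (hd : d ∣ Fintype.card F - 1) {f : F[X]} (hdeg : 0 < f.natDegree) (hsf : Squarefree f) :
    |(#{x : F | ∃ y : Fˣ, f.eval x = (y : F) ^ d} : ℝ) -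
        ((Fintype.card F : ℝ) - #f.roots.toFinset) / d| ≤
      ((d : ℝ) - 1) / d * ((f.natDegree : ℝ) - 1) * √(Fintype.card F) := by
  have hd0 : 0 < d := Nat.pos_of_dvd_of_pos hd (Nat.sub_pos_of_lt Fintype.one_lt_card)
  obtain ⟨χ, rfl⟩ := MulChar.exists_mulChar_orderOf F hd (Complex.isPrimitiveRoot_exp d hd0.ne')
  set d := orderOf χ with hdχ
  set N := #{x : F | ∃ y : Fˣ, f.eval x = (y : F) ^ d}
  have htotal : ∑ j ∈ range d, ∑ x, (χ ^ j) (f.eval x) = (d : ℂ) * N := by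
    rw [sum_comm]
    simp_rw [hdχ, sum_range_mulChar_pow_apply, ← hdχ]
    rw [← sum_filter, sum_const, nsmul_eq_mul, mul_comm]
  have hzero : ∑ x, (χ ^ 0) (f.eval x) = (Fintype.card F : ℂ) - #f.roots.toFinset := by
    have hroots : univ.filter (· ∈ f.roots.toFinset) = f.roots.toFinset := by
      ext x
      rw [mem_filter_univ]
    have h1 : ∀ x, (χ ^ 0) (f.eval x) = 1 - if x ∈ f.roots.toFinset then 1 else 0 := by
      intro x
      have hx : x ∈ f.roots.toFinset ↔ f.eval x = 0 := by
        rw [Multiset.mem_toFinset, mem_roots hsf.ne_zero, IsRoot]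
      rw [pow_zero]
      split_ifs with h
      · rw [hx.mp h, MulChar.map_zero, sub_self]
      · rw [MulChar.one_apply (Ne.isUnit (mt hx.mpr h)), sub_zero]
    rw [sum_congr rfl fun x _ => h1 x, sum_sub_distrib, sum_boole, hroots, sum_const, card_univ,
      nsmul_one]
  have hbound : ‖(d : ℂ) * N - ((Fintype.card F : ℂ) - #f.roots.toFinset)‖ ≤
      ((d : ℝ) - 1) * (((f.natDegree : ℝ) - 1) * √(Fintype.card F)) := by
    rw [← htotal, ← hzero, ← sum_erase_eq_sub (mem_range.mpr hd0)]
    refine (norm_sum_le_of_le _ fun j hj => norm_sum_mulChar_eval_le hsf hdeg ?_).trans_eq ?_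
    · rw [mem_erase, mem_range] at hj
      exact pow_ne_one_of_lt_orderOf hj.1 hj.2
    · rw [sum_const, card_erase_of_mem (mem_range.mpr hd0), card_range, nsmul_eq_mul,
        Nat.cast_sub hd0, Nat.cast_one]
  have hd' : (0 : ℝ) < d := by exact_mod_cast hd0
  have hreal : |(d : ℝ) * N - ((Fintype.card F : ℝ) - #f.roots.toFinset)| ≤
      ((d : ℝ) - 1) * (((f.natDegree : ℝ) - 1) * √(Fintype.card F)) := by
    rw [← Real.norm_eq_abs, ← Complex.norm_real]
    push_cast
    exact hbound
  have hdiv : (N : ℝ) - ((Fintype.card F : ℝ) - #f.roots.toFinset) / d =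
      ((d : ℝ) * N - ((Fintype.card F : ℝ) - #f.roots.toFinset)) / d := by
    field_simp
  rw [hdiv, abs_div, abs_of_pos hd', div_le_iff₀ hd']
  refine hreal.trans_eq ?_
  field_simp

end PowerResidues

open scoped Classical in
theorem statement11 (p : ℕ) [Fact p.Prime] (d : ℕ) (hd : d ∣ p - 1)
    (f : Polynomial (ZMod p)) (hf : 0 < f.natDegree) (hsf : Squarefree f) :
    |(((Finset.range p).filter
          (fun n => ∃ y : (ZMod p)ˣ, f.eval (n : ZMod p) = (y : ZMod p) ^ d)).card : ℝ) -
        ((p : ℝ) - f.roots.toFinset.card) / d| ≤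
      ((d : ℝ) - 1) / d * ((f.natDegree : ℝ) - 1) * Real.sqrt p := by
  have hrange : (do let a ← range p; pure (a : ZMod p) : Finset (ZMod p)) = univ := by
    ext x
    simp only [Finset.pure_def, Finset.bind_def, Finset.mem_sup, mem_singleton, mem_range, mem_univ,
      iff_true]
    exact ⟨x.val, ZMod.val_lt x, ZMod.natCast_zmod_val x |>.symm⟩
  have h := abs_card_filter_eval_eq_pow_sub_le (d := d) (by rwa [ZMod.card]) hf hsf
  rw [ZMod.card] at h
  rw [hrange]
  convert h
end
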